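/- Let k ≥ 1 be an integer. If two planar systems of the form (1.9), say x' = y + X(x,y), y' = Y(x,y) and x' = y + X̃(x,y), y' = Ỹ(x,y), both satisfy conditions (1.11) and (1.12) with the same n ≥ 2, and the Taylor expansions of X and X̃ at the origin agree up to degree (k+2)n − 2, and likewise those of Y and Ỹ, then the coefficients v₁, v₂, …, v_{kn} of the expansions of their respective Poincaré return maps (for x₀ > 0 small, P(x₀) − x₀ = Σ_{j≥1} v_j x₀^j) coincide. -/

import Mathlib

open Set Filter Metric

/-- `P` is the Poincaré return map (near the origin, with respect to the section
`y = F(x)`) of the planar system `p' = (f₁(p), f₂(p))`. -/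
def IsReturnMap (f₁ f₂ : ℝ × ℝ → ℝ) (F : ℝ → ℝ) (P : ℝ → ℝ) : Prop :=
  P 0 = 0 ∧ ∃ ε > 0, ∀ x₀ : ℝ, x₀ ≠ 0 → |x₀| < ε →
    ∃ γ : ℝ → ℝ × ℝ, γ 0 = (x₀, F x₀) ∧
      (∀ t : ℝ,
        HasDerivAt (fun s => (γ s).1) (f₁ (γ t)) t ∧
        HasDerivAt (fun s => (γ s).2) (f₂ (γ t)) t) ∧
      ∃ τ : ℝ, 0 < τ ∧ ((γ τ).2 = F (γ τ).1 ∧ 0 < x₀ * (γ τ).1) ∧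
        (∀ t : ℝ, 0 < t → t < τ → ¬((γ t).2 = F (γ t).1 ∧ 0 < x₀ * (γ t).1)) ∧
        P x₀ = (γ τ).1

/-- The hypotheses of Corollary 1.1 for one system (1.9) `x' = y + X(x,y)`,
`y' = Y(x,y)`: conditions (1.11)–(1.12) hold and `P̄` is the analytic extension of
the Poincaré return map provided by Theorem 1.4. -/
def System19Setup (n : ℕ) (XX YY : ℝ × ℝ → ℝ) (F g f : ℝ → ℝ) (a b : ℝ)
    (P Pb : ℝ → ℝ) : Prop :=
  AnalyticAt ℝ XX (0, 0) ∧ AnalyticAt ℝ YY (0, 0) ∧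
  XX =O[nhds (0 : ℝ × ℝ)] (fun p => ‖p‖ ^ 2) ∧
  YY =O[nhds (0 : ℝ × ℝ)] (fun p => ‖p‖ ^ 2) ∧
  -- `y = F(x)` is the analytic solution of `y + X(x,y) = 0`, `F(0) = 0`
  AnalyticAt ℝ F 0 ∧ F 0 = 0 ∧ (∀ᶠ x in nhds (0 : ℝ), F x + XX (x, F x) = 0) ∧
  -- the functions (1.10)
  (∀ x, g x = -YY (x, F x)) ∧
  (∀ x, f x = -(deriv (fun s => XX (s, F x)) x + deriv (fun s => YY (x, s)) (F x))) ∧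
  -- condition (1.11)
  0 < a ∧
  (∃ u : ℝ → ℝ, AnalyticAt ℝ u 0 ∧ u 0 = a ∧
    ∀ᶠ x in nhds (0 : ℝ), g x = x ^ (2 * n - 1) * u x) ∧
  -- condition (1.12)
  (∃ w : ℝ → ℝ, AnalyticAt ℝ w 0 ∧ w 0 = b ∧
    ∀ᶠ x in nhds (0 : ℝ), f x = x ^ (n - 1) * w x) ∧
  b ^ 2 - 4 * n * a < 0 ∧
  -- the Poincaré return map and its analytic extension
  IsReturnMap (fun p => p.2 + XX p) YY F P ∧
  AnalyticAt ℝ Pb 0 ∧ Pb 0 = 0 ∧ 0 < deriv Pb 0 ∧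
  (∀ᶠ x₀ in nhdsWithin (0 : ℝ) (Ioi 0), P x₀ = Pb x₀)

/-- The Picard–Lindelöf theorem, recording that the solution stays in the ball where the vector
field is controlled. -/
lemma IsPicardLindelof.exists_forall_mem_closedBall {E : Type*} [NormedAddCommGroup E]
    [NormedSpace ℝ E] [CompleteSpace E] {f : ℝ → E → E} {tmin tmax : ℝ} {t₀ : Icc tmin tmax}
    {x₀ : E} {a L K : NNReal} (hf : IsPicardLindelof f t₀ x₀ a 0 L K) :
    ∃ α : ℝ → E, α t₀ = x₀ ∧ ∀ t ∈ Icc tmin tmax,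
      α t ∈ closedBall x₀ a ∧ HasDerivWithinAt α (f t (α t)) (Icc tmin tmax) t := by
  have hx : x₀ ∈ closedBall x₀ ((0 : NNReal) : ℝ) := by simp
  obtain ⟨α, hα⟩ := ODE.FunSpace.exists_isFixedPt_next hf hx
  have hfix : ∀ t ∈ Icc tmin tmax, α.compProj t = ODE.picard f t₀ x₀ α.compProj t := by
    intro t ht
    conv_lhs => rw [← hα.eq]
    rw [ODE.FunSpace.compProj_apply, ODE.FunSpace.next_apply, projIcc_of_mem _ ht]
  refine ⟨α.compProj, ?_, fun t ht => ⟨α.compProj_mem_closedBall hf.mul_max_le, ?_⟩⟩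
  · rw [hfix _ t₀.2, ODE.picard_apply₀]
  · refine (ODE.hasDerivWithinAt_picard_Icc t₀.2 hf.continuousOn_uncurry
      α.continuous_compProj.continuousOn
      (fun t _ => α.compProj_mem_closedBall hf.mul_max_le) x₀ ht).congr_of_mem hfix ht

/-- Two solutions of a locally Lipschitz differential equation on an open interval coincide as soon
as they meet and one of them stays in the open set where the equation is Lipschitz. -/
lemma ODE_solution_eqOn_Ioo {E : Type*} [NormedAddCommGroup E] [NormedSpace ℝ E]
    {v : ℝ → E → E} {s : Set E} (hs : IsOpen s) {f g : ℝ → E} {a b t₀ : ℝ} (ht₀ : t₀ ∈ Ioo a b)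
    (hv : ∀ t ∈ Ioo a b, ∃ K, ∀ᶠ t' in nhds t, LipschitzOnWith K (v t') s)
    (hf : ∀ t ∈ Ioo a b, HasDerivAt f (v t (f t)) t)
    (hg : ∀ t ∈ Ioo a b, HasDerivAt g (v t (g t)) t ∧ g t ∈ s) (heq : f t₀ = g t₀) :
    EqOn f g (Ioo a b) := by
  have key : ∀ t ∈ Ioo a b, f t = g t → f =ᶠ[nhds t] g := by
    intro t ht hfg
    obtain ⟨K, hK⟩ := hv t ht
    have hnear : ∀ᶠ t' in nhds t, t' ∈ Ioo a b := isOpen_Ioo.mem_nhds ht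
    have hfs : ∀ᶠ t' in nhds t, f t' ∈ s :=
      (hf t ht).continuousAt.eventually (hs.mem_nhds (hfg ▸ (hg t ht).2))
    refine ODE_solution_unique_of_eventually (v := v) (s := fun _ => s) hK ?_ ?_ hfg
    · filter_upwards [hnear, hfs] with t' h1 h2 using ⟨hf t' h1, h2⟩
    · filter_upwards [hnear] with t' h1 using hg t' h1
  have hsub : Ioo a b ⊆ {t | f =ᶠ[nhds t] g} := by
    refine isPreconnected_Ioo.subset_of_closure_inter_subset isOpen_setOfPred_eventually_nhds
      ⟨t₀, ht₀, key t₀ ht₀ heq⟩ ?_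
    rintro t ⟨htc, ht⟩
    refine key t ht ?_
    have hfreq : ∃ᶠ t' in nhds t, f t' = g t' :=
      (mem_closure_iff_frequently.1 htc).mono fun t' h => h.self_of_nhds
    exact tendsto_nhds_unique_of_frequently_eq (hf t ht).continuousAt (hg t ht).1.continuousAt hfreq
  exact fun t ht => (hsub ht).self_of_nhds

/-- Two analytic functions with the same Taylor coefficients up to order `N` at a point differ by a
`O(‖y‖ ^ (N + 1))` there. -/
lemma AnalyticAt.isBigO_sub_of_iteratedFDeriv_eq {E F : Type*} [NormedAddCommGroup E]
    [NormedSpace ℝ E] [NormedAddCommGroup F] [NormedSpace ℝ F] [CompleteSpace F] {f g : E → F}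
    {x : E} (hf : AnalyticAt ℝ f x) (hg : AnalyticAt ℝ g x) {N : ℕ}
    (h : ∀ j ≤ N, iteratedFDeriv ℝ j f x = iteratedFDeriv ℝ j g x) :
    (fun y => f (x + y) - g (x + y)) =O[nhds 0] fun y => ‖y‖ ^ (N + 1) := by
  obtain ⟨p, r, hp⟩ := hf
  obtain ⟨q, r', hq⟩ := hg
  have hpq : ∀ y, p.partialSum (N + 1) y = q.partialSum (N + 1) y := by
    intro y
    refine Finset.sum_congr rfl fun j hj => ?_
    have h1 := hp.factorial_smul y j
    rw [h j (Nat.lt_succ_iff.1 (Finset.mem_range.1 hj)), ← hq.factorial_smul y j] at h1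
    rw [← Nat.cast_smul_eq_nsmul ℝ, ← Nat.cast_smul_eq_nsmul ℝ] at h1
    exact smul_right_injective F (Nat.cast_ne_zero.2 (Nat.factorial_ne_zero j)) h1
  have h1 := (hp.hasFPowerSeriesAt.isBigO_sub_partialSum_pow (N + 1)).sub
    (hq.hasFPowerSeriesAt.isBigO_sub_partialSum_pow (N + 1))
  refine h1.congr_left fun y => ?_
  rw [hpq]
  abel

/-- An analytic function of one real variable which is `O(x ^ m)` as `x → 0⁺` vanishes to order `m`
at the origin. -/
lemma AnalyticAt.le_analyticOrderAt_of_isBigO_right {f : ℝ → ℝ} (hf : AnalyticAt ℝ f 0) {m : ℕ}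
    (h : f =O[nhdsWithin 0 (Ioi 0)] fun x => x ^ m) : (m : ℕ∞) ≤ analyticOrderAt f 0 := by
  by_contra! hlt
  obtain ⟨d, hd⟩ := ENat.ne_top_iff_exists.1 hlt.ne_top
  rw [← hd, Nat.cast_lt] at hlt
  obtain ⟨g, hg, hg0, hfg⟩ := (hf.analyticOrderAt_eq_natCast).1 hd.symm
  obtain ⟨C, hC⟩ := h.bound
  have h1 : ∀ᶠ x in nhdsWithin (0 : ℝ) (Ioi 0), ‖g x‖ ≤ C * x ^ (m - d) := by
    filter_upwards [hC, hfg.filter_mono nhdsWithin_le_nhds, self_mem_nhdsWithin] with x h1 h2 hx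
    have hx : 0 < x := hx
    rw [h2, sub_zero, smul_eq_mul, norm_mul, norm_pow, norm_pow, Real.norm_of_nonneg hx.le] at h1
    have h3 : x ^ m = x ^ d * x ^ (m - d) := by rw [← pow_add]; congr 1; omega
    rw [h3] at h1
    refine le_of_mul_le_mul_left ?_ (pow_pos hx d)
    linarith
  have h2 : Tendsto (fun x => ‖g x‖) (nhdsWithin 0 (Ioi 0)) (nhds ‖g 0‖) :=
    hg.continuousAt.norm.mono_left nhdsWithin_le_nhds
  have h3 : Tendsto (fun x : ℝ => C * x ^ (m - d)) (nhdsWithin 0 (Ioi 0)) (nhds 0) := by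
    have : Tendsto (fun x : ℝ => C * x ^ (m - d)) (nhds 0) (nhds (C * 0 ^ (m - d))) :=
      (by fun_prop : Continuous fun x : ℝ => C * x ^ (m - d)).tendsto 0
    rw [zero_pow (by omega), mul_zero] at this
    exact this.mono_left nhdsWithin_le_nhds
  have := le_of_tendsto_of_tendsto h2 h3 h1
  exact hg0 (norm_le_zero_iff.1 this)

/-- Averaging an analytic function of two variables along the segments `{x} × [0, z]`
produces an analytic function. -/
lemma analyticAt_integral_segment {f : ℝ × ℝ → ℝ} (hf : AnalyticAt ℝ f (0, 0)) :
    AnalyticAt ℝ (fun p : ℝ × ℝ => ∫ s in (0 : ℝ)..1, f (p.1, s * p.2)) (0, 0) := by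
  obtain ⟨p, R, hp⟩ := hf
  let L : ℝ → (ℝ × ℝ →L[ℝ] ℝ × ℝ) := fun s =>
    (ContinuousLinearMap.fst ℝ ℝ ℝ).prod (s • ContinuousLinearMap.snd ℝ ℝ ℝ)
  have hLcont : Continuous L := by
    have h : L = fun s => (ContinuousLinearMap.inl ℝ ℝ ℝ).comp (ContinuousLinearMap.fst ℝ ℝ ℝ) +
        s • (ContinuousLinearMap.inr ℝ ℝ ℝ).comp (ContinuousLinearMap.snd ℝ ℝ ℝ) := by
      funext s
      ext <;> simp [L]
    rw [h]
    fun_prop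
  have hLapp : ∀ s v, L s v = (v.1, s * v.2) := fun s v => by simp [L]
  have hLvec : ∀ s ∈ Icc (0 : ℝ) 1, ∀ v, ‖L s v‖ ≤ ‖v‖ := by
    intro s hs v
    rw [hLapp, Prod.norm_mk]
    refine max_le (norm_fst_le v) ?_
    rw [norm_mul, Real.norm_of_nonneg hs.1]
    calc s * ‖v.2‖ ≤ 1 * ‖v.2‖ := by gcongr; exact hs.2
      _ ≤ ‖v‖ := by rw [one_mul]; exact norm_snd_le v
  have hLnorm : ∀ s ∈ Icc (0 : ℝ) 1, ‖L s‖ ≤ 1 := fun s hs =>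
    ContinuousLinearMap.opNorm_le_bound _ zero_le_one fun v => by
      rw [one_mul]; exact hLvec s hs v
  let G : ∀ k : ℕ, ℝ → ContinuousMultilinearMap ℝ (fun _ : Fin k => ℝ × ℝ) ℝ := fun k s =>
    (p k).compContinuousLinearMap fun _ => L s
  have hGcont : ∀ k, Continuous (G k) := by
    intro k
    have h1 : Continuous fun s : ℝ =>
        ContinuousMultilinearMap.compContinuousLinearMapContinuousMultilinear ℝ
          (fun _ : Fin k => ℝ × ℝ) (fun _ : Fin k => ℝ × ℝ) ℝ (fun _ => L s) :=
      (ContinuousMultilinearMap.cont _).comp (continuous_pi fun _ => hLcont)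
    exact h1.clm_apply continuous_const
  have hGnorm : ∀ k, ∀ s ∈ Icc (0 : ℝ) 1, ‖G k s‖ ≤ ‖p k‖ := by
    intro k s hs
    refine (ContinuousMultilinearMap.norm_compContinuousLinearMap_le _ _).trans ?_
    refine mul_le_of_le_one_right (norm_nonneg _) ?_
    exact Finset.prod_le_one (fun _ _ => norm_nonneg _) fun _ _ => hLnorm s hs
  let q : FormalMultilinearSeries ℝ (ℝ × ℝ) ℝ := fun k => ∫ s in (0 : ℝ)..1, G k s
  have hqapp : ∀ k v, q k v = ∫ s in (0 : ℝ)..1, G k s v := by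
    intro k v
    have := ContinuousLinearMap.intervalIntegral_comp_comm
      (ContinuousMultilinearMap.apply ℝ (fun _ : Fin k => ℝ × ℝ) ℝ v)
      ((hGcont k).intervalIntegrable (μ := MeasureTheory.volume) 0 1)
    simpa using this.symm
  have hqnorm : ∀ k, ‖q k‖ ≤ ‖p k‖ := by
    intro k
    have := intervalIntegral.norm_integral_le_of_norm_le_const (a := 0) (b := 1) (f := G k)
      (C := ‖p k‖) fun s hs => by
        rw [uIoc_of_le zero_le_one] at hs
        exact hGnorm k s ⟨hs.1.le, hs.2⟩
    simpa using this
  obtain ⟨r, hr0, hrR⟩ := ENNReal.lt_iff_exists_nnreal_btwn.1 hp.r_pos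
  have hrp : (r : ENNReal) < p.radius := hrR.trans_le hp.r_le
  refine ⟨q, r, ?_, hr0, ?_⟩
  · obtain ⟨C, -, hC⟩ := p.norm_mul_pow_le_of_lt_radius hrp
    exact q.le_radius_of_bound C fun k => (by gcongr; exact hqnorm k : _ ≤ _).trans (hC k)
  · intro y hy
    have hyr : ‖y‖ < r := by
      simpa [Metric.eball_coe] using hy
    have hsum := intervalIntegral.hasSum_integral_of_dominated_convergence
      (a := 0) (b := 1) (μ := MeasureTheory.volume)
      (F := fun k s => G k s fun _ => y) (f := fun s => f (y.1, s * y.2))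
      (bound := fun k _ => ‖p k‖ * (r : ℝ) ^ k) ?_ ?_ ?_ ?_ ?_
    · simpa [hqapp] using hsum
    · intro k
      exact (((ContinuousMultilinearMap.apply ℝ (fun _ : Fin k => ℝ × ℝ) ℝ
        fun _ => y).continuous.comp (hGcont k))).aestronglyMeasurable
    · intro k
      refine Eventually.of_forall fun s hs => ?_
      rw [uIoc_of_le zero_le_one] at hs
      calc ‖G k s fun _ => y‖ ≤ ‖G k s‖ * ∏ _i : Fin k, ‖y‖ := (G k s).le_opNorm _
        _ = ‖G k s‖ * ‖y‖ ^ k := by simp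
        _ ≤ ‖p k‖ * (r : ℝ) ^ k := by
          gcongr
          exact hGnorm k s ⟨hs.1.le, hs.2⟩
    · exact Eventually.of_forall fun s _ => p.summable_norm_mul_pow hrp
    · exact intervalIntegrable_const
    · refine Eventually.of_forall fun s hs => ?_
      rw [uIoc_of_le zero_le_one] at hs
      have h1 : L s y ∈ Metric.eball (0 : ℝ × ℝ) R := by
        refine Metric.eball_subset_eball hrR.le ?_
        simpa [Metric.eball_coe] using (hLvec s ⟨hs.1.le, hs.2⟩ y).trans_lt hyr
      have h2 := hp.hasSum h1
      simpa [hLapp, G, Function.comp_def] using h2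

/-- An analytic function of two variables that vanishes on the first axis is divisible by the
second coordinate. -/
lemma AnalyticAt.exists_eq_snd_mul {f : ℝ × ℝ → ℝ} (hf : AnalyticAt ℝ f (0, 0))
    (h0 : ∀ᶠ x in nhds (0 : ℝ), f (x, 0) = 0) :
    ∃ g : ℝ × ℝ → ℝ, AnalyticAt ℝ g (0, 0) ∧ ∀ᶠ p in nhds ((0, 0) : ℝ × ℝ), f p = p.2 * g p := by
  have hd : AnalyticAt ℝ (fun p : ℝ × ℝ => fderiv ℝ f p (0, 1)) (0, 0) := by
    have := hf.fderiv
    exact ((ContinuousLinearMap.apply ℝ ℝ ((0, 1) : ℝ × ℝ)).analyticAt _).comp this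
  refine ⟨_, analyticAt_integral_segment hd, ?_⟩
  have h0' : ∀ᶠ p in nhds ((0, 0) : ℝ × ℝ), f (p.1, 0) = 0 :=
    (continuous_fst.tendsto ((0, 0) : ℝ × ℝ)).eventually h0
  obtain ⟨ε, hε, hball⟩ := Metric.eventually_nhds_iff_ball.1 (hf.eventually_analyticAt)
  filter_upwards [h0', Metric.ball_mem_nhds _ hε] with p hp0 hpε
  have hmem : ∀ s ∈ Icc (0 : ℝ) 1, (p.1, s * p.2) ∈ ball ((0, 0) : ℝ × ℝ) ε := by
    intro s hs
    rw [mem_ball_iff_norm] at hpε ⊢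
    refine lt_of_le_of_lt ?_ hpε
    simp only [Prod.mk_sub_mk, sub_zero, Prod.norm_def, Prod.fst_sub, Prod.snd_sub]
    gcongr
    rw [norm_mul, Real.norm_of_nonneg hs.1]
    exact mul_le_of_le_one_left (norm_nonneg _) hs.2
  have hderiv : ∀ s ∈ uIcc (0 : ℝ) 1, HasDerivAt (fun s => f (p.1, s * p.2))
      (p.2 * fderiv ℝ f (p.1, s * p.2) (0, 1)) s := by
    intro s hs
    rw [uIcc_of_le zero_le_one] at hs
    have h1 := (hball _ (hmem s hs)).differentiableAt.hasFDerivAt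
    have h2 : HasDerivAt (fun s : ℝ => (p.1, s * p.2)) (0, 1 * p.2) s :=
      (hasDerivAt_const s p.1).prodMk ((hasDerivAt_id s).mul_const p.2)
    have h3 := h1.comp_hasDerivAt s h2
    have h4 : ((0 : ℝ), 1 * p.2) = p.2 • ((0 : ℝ), (1 : ℝ)) := by simp
    rw [h4, map_smul, smul_eq_mul] at h3
    exact h3
  have hcont : ContinuousOn (fun s => p.2 * fderiv ℝ f (p.1, s * p.2) (0, 1)) (uIcc 0 1) := by
    intro s hs
    rw [uIcc_of_le zero_le_one] at hs
    have h1 : ContinuousAt (fderiv ℝ f) (p.1, s * p.2) := (hball _ (hmem s hs)).fderiv.continuousAt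
    have h2 : ContinuousAt (fun s : ℝ => fderiv ℝ f (p.1, s * p.2)) s :=
      ContinuousAt.comp (f := fun s : ℝ => (p.1, s * p.2)) h1 (by fun_prop)
    exact (continuousAt_const.mul (h2.clm_apply continuousAt_const)).continuousWithinAt
  have := intervalIntegral.integral_eq_sub_of_hasDerivAt hderiv hcont.intervalIntegrable
  rw [intervalIntegral.integral_const_mul] at this
  simpa [hp0] using this.symm

attribute [local fun_prop] analyticAt_fst analyticAt_snd

/-- First component of the planar system after straightening the curve `y = F x` to the axis
`z = 0` by `z = y - F x`. -/
noncomputable def straightX (X : ℝ × ℝ → ℝ) (F : ℝ → ℝ) (v : ℝ × ℝ) : ℝ :=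
  F v.1 + v.2 + X (v.1, F v.1 + v.2)

/-- Second component of the planar system after straightening the curve `y = F x` to the axis
`z = 0` by `z = y - F x`. -/
noncomputable def straightY (X Y : ℝ × ℝ → ℝ) (F : ℝ → ℝ) (v : ℝ × ℝ) : ℝ :=
  Y (v.1, F v.1 + v.2) - deriv F v.1 * straightX X F v

/-- The weighted polar blow-up `(ρ, φ) ↦ (ρ cos φ, -ρⁿ sin φ)`. -/
noncomputable def blowPoint (n : ℕ) (ρ φ : ℝ) : ℝ × ℝ :=
  (ρ * Real.cos φ, -(ρ ^ n * Real.sin φ))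

/-- `M` and `T` are analytic near `ρ = 0` and describe the planar field `(p, q)` in weighted polar
coordinates: up to a common positive factor, `ρ' / ρ` is `M` and `φ' > 0` is `T`. -/
structure IsBlowUp (n : ℕ) (p q M T : ℝ × ℝ → ℝ) : Prop where
  analyticAt_radial (φ : ℝ) : AnalyticAt ℝ M (0, φ)
  analyticAt_angular (φ : ℝ) : AnalyticAt ℝ T (0, φ)
  angular_pos (φ : ℝ) : 0 < T (0, φ)
  eventually_radial (φ : ℝ) : ∀ᶠ z in nhds ((0, φ) : ℝ × ℝ), z.1 ^ (2 * n - 1) * M z =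
    z.1 ^ (n - 1) * Real.cos z.2 * p (blowPoint n z.1 z.2) -
      Real.sin z.2 * q (blowPoint n z.1 z.2)
  eventually_angular (φ : ℝ) : ∀ᶠ z in nhds ((0, φ) : ℝ × ℝ), z.1 ^ (2 * n - 1) * T z =
    -(n * z.1 ^ (n - 1) * Real.sin z.2 * p (blowPoint n z.1 z.2)) -
      Real.cos z.2 * q (blowPoint n z.1 z.2)

lemma tendsto_blowPoint {n : ℕ} (hn : n ≠ 0) (φ : ℝ) :
    Tendsto (fun z : ℝ × ℝ => blowPoint n z.1 z.2) (nhds (0, φ)) (nhds (0, 0)) := by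
  have h : Continuous fun z : ℝ × ℝ => blowPoint n z.1 z.2 := by unfold blowPoint; fun_prop
  simpa [blowPoint, hn] using h.tendsto (0, φ)

lemma analyticAt_blowPoint (n : ℕ) (z : ℝ × ℝ) :
    AnalyticAt ℝ (fun z : ℝ × ℝ => blowPoint n z.1 z.2) z := by
  unfold blowPoint
  fun_prop

lemma hasDerivAt_of_eventually_eq_snd_mul {f g : ℝ × ℝ → ℝ} (hg : AnalyticAt ℝ g (0, 0))
    (h : ∀ᶠ p in nhds ((0, 0) : ℝ × ℝ), f p = p.2 * g p) :
    ∀ᶠ x in nhds (0 : ℝ), HasDerivAt (fun z => f (x, z)) (g (x, 0)) 0 := by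
  have hx : Tendsto (fun x : ℝ => (x, (0 : ℝ))) (nhds 0) (nhds (0, 0)) :=
    (by fun_prop : Continuous fun x : ℝ => (x, (0 : ℝ))).tendsto 0
  filter_upwards [hx.eventually h.eventually_nhds, hx.eventually hg.eventually_analyticAt]
    with x h1 h2
  have hz : Tendsto (fun z : ℝ => (x, z)) (nhds 0) (nhds (x, 0)) :=
    (by fun_prop : Continuous fun z : ℝ => (x, z)).tendsto 0
  have h3 : DifferentiableAt ℝ (fun z : ℝ => g (x, z)) 0 :=
    DifferentiableAt.comp (g := g) (f := fun z : ℝ => (x, z)) 0 h2.differentiableAt (by fun_prop)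
  have h4 := (hasDerivAt_id (0 : ℝ)).mul h3.hasDerivAt
  simp only [id_eq, one_mul, zero_mul, add_zero] at h4
  exact h4.congr_of_eventuallyEq (hz.eventually h1)

/-- Normal form of a field near a nilpotent monodromic point, after straightening. -/
lemma exists_normal_form {p q : ℝ × ℝ → ℝ} {u w : ℝ → ℝ} {n : ℕ}
    (hp : AnalyticAt ℝ p (0, 0)) (hq : AnalyticAt ℝ q (0, 0)) (hu : AnalyticAt ℝ u 0)
    (hw : AnalyticAt ℝ w 0) (hp0 : ∀ᶠ x in nhds (0 : ℝ), p (x, 0) = 0)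
    (hp1 : HasDerivAt (fun z => p (0, z)) 1 0)
    (hq0 : ∀ᶠ x in nhds (0 : ℝ), q (x, 0) = -(x ^ (2 * n - 1) * u x))
    (hq1 : ∀ᶠ x in nhds (0 : ℝ), HasDerivAt (fun z => q (x, z)) (-(x ^ (n - 1) * w x)) 0) :
    ∃ A B : ℝ × ℝ → ℝ, AnalyticAt ℝ A (0, 0) ∧ AnalyticAt ℝ B (0, 0) ∧ A (0, 0) = 1 ∧
      (∀ᶠ v in nhds ((0, 0) : ℝ × ℝ), p v = v.2 * A v) ∧
      ∀ᶠ v in nhds ((0, 0) : ℝ × ℝ),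
        q v = -(v.1 ^ (2 * n - 1) * u v.1) - v.1 ^ (n - 1) * w v.1 * v.2 + v.2 ^ 2 * B v := by
  have hu' : AnalyticAt ℝ (fun v : ℝ × ℝ => u v.1) (0, 0) :=
    AnalyticAt.comp (g := u) (f := Prod.fst) hu analyticAt_fst
  have hw' : AnalyticAt ℝ (fun v : ℝ × ℝ => w v.1) (0, 0) :=
    AnalyticAt.comp (g := w) (f := Prod.fst) hw analyticAt_fst
  obtain ⟨A, hA, hpA⟩ := hp.exists_eq_snd_mul hp0
  obtain ⟨q₁, hq₁, hqq⟩ := AnalyticAt.exists_eq_snd_mul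
    (f := fun v => q v + v.1 ^ (2 * n - 1) * u v.1) (by fun_prop) (by
      filter_upwards [hq0] with x hx
      simp [hx])
  obtain ⟨B, hB, hqB⟩ := AnalyticAt.exists_eq_snd_mul
    (f := fun v => q₁ v + v.1 ^ (n - 1) * w v.1) (by fun_prop) (by
      filter_upwards [hasDerivAt_of_eventually_eq_snd_mul hq₁ hqq, hq1] with x h1 h2
      have := h1.unique (h2.add_const (x ^ (2 * n - 1) * u x))
      simp [this])
  refine ⟨A, B, hA, hB, ?_, hpA, ?_⟩
  · exact (hasDerivAt_of_eventually_eq_snd_mul hA hpA).self_of_nhds.unique hp1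
  · filter_upwards [hqq, hqB] with v h1 h2
    linear_combination h1 + v.2 * h2

lemma monodromy_form_pos {n : ℕ} (hn : 1 ≤ n) {a b : ℝ} (hab : b ^ 2 - 4 * n * a < 0) (φ : ℝ) :
    0 < n * Real.sin φ ^ 2 - b * Real.cos φ ^ n * Real.sin φ + a * (Real.cos φ ^ n) ^ 2 := by
  have hn' : (0 : ℝ) < n := by exact_mod_cast hn
  rcases eq_or_ne (Real.cos φ) 0 with hc | hc
  · have : Real.sin φ ^ 2 = 1 := by simpa [hc] using Real.sin_sq_add_cos_sq φ
    rw [hc, zero_pow (by omega), this]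
    simpa using hn'
  · have hc2 : 0 < (Real.cos φ ^ n) ^ 2 := by positivity
    have h1 : 0 < (4 * n * a - b ^ 2) * (Real.cos φ ^ n) ^ 2 := mul_pos (by linarith) hc2
    have h2 := sq_nonneg (2 * n * Real.sin φ - b * Real.cos φ ^ n)
    by_contra! h
    nlinarith

/-- The weighted polar blow-up of a field in normal form is regular along `ρ = 0`. -/
lemma exists_isBlowUp {p q A B : ℝ × ℝ → ℝ} {u w : ℝ → ℝ} {n : ℕ} (hn : 1 ≤ n)
    (hA : AnalyticAt ℝ A (0, 0)) (hB : AnalyticAt ℝ B (0, 0)) (hu : AnalyticAt ℝ u 0)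
    (hw : AnalyticAt ℝ w 0) (hA1 : A (0, 0) = 1) (huw : w 0 ^ 2 - 4 * n * u 0 < 0)
    (hp : ∀ᶠ v in nhds ((0, 0) : ℝ × ℝ), p v = v.2 * A v)
    (hq : ∀ᶠ v in nhds ((0, 0) : ℝ × ℝ),
      q v = -(v.1 ^ (2 * n - 1) * u v.1) - v.1 ^ (n - 1) * w v.1 * v.2 + v.2 ^ 2 * B v) :
    ∃ M T, IsBlowUp n p q M T := by
  obtain ⟨m, rfl⟩ : ∃ m, n = m + 1 := ⟨n - 1, by omega⟩
  have e1 : 2 * (m + 1) - 1 = 2 * m + 1 := by omega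
  rw [e1] at hq
  simp only [Nat.add_sub_cancel] at hq
  let Q : ℝ × ℝ → ℝ := fun z => -(Real.cos z.2 ^ (2 * m + 1) * u (z.1 * Real.cos z.2)) +
    Real.cos z.2 ^ m * Real.sin z.2 * w (z.1 * Real.cos z.2) +
    z.1 * Real.sin z.2 ^ 2 * B (blowPoint (m + 1) z.1 z.2)
  have hblow0 : ∀ φ, blowPoint (m + 1) (0, φ).1 (0, φ).2 = (0, 0) := by simp [blowPoint]
  have hA' : ∀ φ, AnalyticAt ℝ (fun z : ℝ × ℝ => A (blowPoint (m + 1) z.1 z.2)) (0, φ) := fun φ =>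
    AnalyticAt.comp (g := A) (f := fun z : ℝ × ℝ => blowPoint (m + 1) z.1 z.2)
      (by rwa [hblow0]) (analyticAt_blowPoint _ _)
  have hB' : ∀ φ, AnalyticAt ℝ (fun z : ℝ × ℝ => B (blowPoint (m + 1) z.1 z.2)) (0, φ) := fun φ =>
    AnalyticAt.comp (g := B) (f := fun z : ℝ × ℝ => blowPoint (m + 1) z.1 z.2)
      (by rwa [hblow0]) (analyticAt_blowPoint _ _)
  have hu' : ∀ φ, AnalyticAt ℝ (fun z : ℝ × ℝ => u (z.1 * Real.cos z.2)) (0, φ) := fun φ =>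
    AnalyticAt.comp (g := u) (f := fun z : ℝ × ℝ => z.1 * Real.cos z.2)
      (by simpa using hu) (by fun_prop)
  have hw' : ∀ φ, AnalyticAt ℝ (fun z : ℝ × ℝ => w (z.1 * Real.cos z.2)) (0, φ) := fun φ =>
    AnalyticAt.comp (g := w) (f := fun z : ℝ × ℝ => z.1 * Real.cos z.2)
      (by simpa using hw) (by fun_prop)
  have hQ : ∀ φ, AnalyticAt ℝ Q (0, φ) := by
    intro φ
    have aux : ∀ {U W V : ℝ × ℝ → ℝ} {z : ℝ × ℝ}, AnalyticAt ℝ U z → AnalyticAt ℝ W z →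
        AnalyticAt ℝ V z → AnalyticAt ℝ (fun z => -(Real.cos z.2 ^ (2 * m + 1) * U z) +
          Real.cos z.2 ^ m * Real.sin z.2 * W z + z.1 * Real.sin z.2 ^ 2 * V z) z := by
      intros
      fun_prop
    exact aux (hu' φ) (hw' φ) (hB' φ)
  have hpq : ∀ φ, ∀ᶠ z in nhds ((0, φ) : ℝ × ℝ),
      p (blowPoint (m + 1) z.1 z.2) =
        -(z.1 ^ (m + 1) * Real.sin z.2) * A (blowPoint (m + 1) z.1 z.2) ∧
      q (blowPoint (m + 1) z.1 z.2) = z.1 ^ (2 * m + 1) * Q z := by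
    intro φ
    filter_upwards [(tendsto_blowPoint (n := m + 1) (by omega) φ).eventually hp,
      (tendsto_blowPoint (n := m + 1) (by omega) φ).eventually hq] with z h1 h2
    refine ⟨h1, h2.trans ?_⟩
    simp only [blowPoint, Q]
    ring
  refine ⟨fun z => -(Real.sin z.2 * (Real.cos z.2 * A (blowPoint (m + 1) z.1 z.2) + Q z)),
    fun z => (m + 1 : ℕ) * Real.sin z.2 ^ 2 * A (blowPoint (m + 1) z.1 z.2) - Real.cos z.2 * Q z,
    ?_, ?_, ?_, ?_, ?_⟩
  · intro φ
    have aux : ∀ {V : ℝ × ℝ → ℝ} {z : ℝ × ℝ}, AnalyticAt ℝ V z → AnalyticAt ℝ Q z →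
        AnalyticAt ℝ (fun z => -(Real.sin z.2 * (Real.cos z.2 * V z + Q z))) z := by
      intros
      fun_prop
    exact aux (hA' φ) (hQ φ)
  · intro φ
    have aux : ∀ {V : ℝ × ℝ → ℝ} {z : ℝ × ℝ}, AnalyticAt ℝ V z → AnalyticAt ℝ Q z → AnalyticAt ℝ
        (fun z => (m + 1 : ℕ) * Real.sin z.2 ^ 2 * V z - Real.cos z.2 * Q z) z := by
      intros
      fun_prop
    exact aux (hA' φ) (hQ φ)
  · intro φ
    have h := monodromy_form_pos hn huw φ
    have e : blowPoint (m + 1) 0 φ = (0, 0) := hblow0 φ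
    simp only [Q, e, hA1, zero_mul, add_zero, mul_one]
    convert h using 1
    ring
  · intro φ
    filter_upwards [hpq φ] with z hz
    rw [hz.1, hz.2, e1, Nat.add_sub_cancel]
    ring
  · intro φ
    filter_upwards [hpq φ] with z hz
    rw [hz.1, hz.2, e1, Nat.add_sub_cancel]
    ring

section Straightening

variable {X Y : ℝ × ℝ → ℝ} {F : ℝ → ℝ}

lemma analyticAt_comp_straighten {H : ℝ × ℝ → ℝ} (hH : AnalyticAt ℝ H (0, 0))
    (hF : AnalyticAt ℝ F 0) (hF0 : F 0 = 0) :
    AnalyticAt ℝ (fun v : ℝ × ℝ => H (v.1, F v.1 + v.2)) (0, 0) := by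
  have hF' : AnalyticAt ℝ (fun v : ℝ × ℝ => F v.1) (0, 0) :=
    AnalyticAt.comp (g := F) (f := Prod.fst) hF analyticAt_fst
  exact AnalyticAt.comp (g := H) (f := fun v : ℝ × ℝ => (v.1, F v.1 + v.2))
    (by simpa [hF0] using hH) (by fun_prop)

lemma analyticAt_straightX (hX : AnalyticAt ℝ X (0, 0)) (hF : AnalyticAt ℝ F 0) (hF0 : F 0 = 0) :
    AnalyticAt ℝ (straightX X F) (0, 0) := by
  have hF' : AnalyticAt ℝ (fun v : ℝ × ℝ => F v.1) (0, 0) :=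
    AnalyticAt.comp (g := F) (f := Prod.fst) hF analyticAt_fst
  exact (hF'.add analyticAt_snd).add (analyticAt_comp_straighten hX hF hF0)

lemma analyticAt_straightY (hX : AnalyticAt ℝ X (0, 0)) (hY : AnalyticAt ℝ Y (0, 0))
    (hF : AnalyticAt ℝ F 0) (hF0 : F 0 = 0) : AnalyticAt ℝ (straightY X Y F) (0, 0) := by
  have hF' : AnalyticAt ℝ (fun v : ℝ × ℝ => deriv F v.1) (0, 0) :=
    AnalyticAt.comp (g := deriv F) (f := Prod.fst) hF.deriv analyticAt_fst
  exact (analyticAt_comp_straighten hY hF hF0).sub (hF'.mul (analyticAt_straightX hX hF hF0))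

lemma tendsto_graph (hF : AnalyticAt ℝ F 0) (hF0 : F 0 = 0) :
    Tendsto (fun x => (x, F x)) (nhds 0) (nhds ((0, 0) : ℝ × ℝ)) := by
  have h : ContinuousAt (fun x => (x, F x)) 0 := continuousAt_id.prodMk hF.continuousAt
  simpa [ContinuousAt, hF0] using h

lemma hasDerivAt_vertical {H : ℝ × ℝ → ℝ} {x y : ℝ} (hH : DifferentiableAt ℝ H (x, y)) :
    HasDerivAt (fun s => H (x, s)) (fderiv ℝ H (x, y) (0, 1)) y :=
  hH.hasFDerivAt.comp_hasDerivAt y ((hasDerivAt_const y x).prodMk (hasDerivAt_id y))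

lemma hasDerivAt_horizontal {H : ℝ × ℝ → ℝ} {x y : ℝ} (hH : DifferentiableAt ℝ H (x, y)) :
    HasDerivAt (fun s => H (s, y)) (fderiv ℝ H (x, y) (1, 0)) x :=
  HasFDerivAt.comp_hasDerivAt (f := fun s : ℝ => (s, y)) x hH.hasFDerivAt
    ((hasDerivAt_id x).prodMk (hasDerivAt_const x y))

lemma hasDerivAt_straightX {x : ℝ} (hX : DifferentiableAt ℝ X (x, F x)) :
    HasDerivAt (fun z => straightX X F (x, z)) (1 + fderiv ℝ X (x, F x) (0, 1)) 0 := by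
  have hz : HasDerivAt (fun z : ℝ => F x + z) 1 0 := (hasDerivAt_id _).const_add _
  have h := HasDerivAt.comp (h := fun z => F x + z) (h₂ := fun s => X (x, s)) 0
    (by simpa using hasDerivAt_vertical hX) hz
  have h' := hz.add h
  rw [mul_one] at h'
  exact h'

lemma hasDerivAt_straightY {x : ℝ} (hX : DifferentiableAt ℝ X (x, F x))
    (hY : DifferentiableAt ℝ Y (x, F x)) :
    HasDerivAt (fun z => straightY X Y F (x, z))
      (fderiv ℝ Y (x, F x) (0, 1) - deriv F x * (1 + fderiv ℝ X (x, F x) (0, 1))) 0 := by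
  have hz : HasDerivAt (fun z : ℝ => F x + z) 1 0 := (hasDerivAt_id _).const_add _
  have h := HasDerivAt.comp (h := fun z => F x + z) (h₂ := fun s => Y (x, s)) 0
    (by simpa using hasDerivAt_vertical hY) hz
  have h' := h.sub ((hasDerivAt_straightX hX).const_mul (deriv F x))
  rw [mul_one] at h'
  exact h'

/-- Differentiating `F x + X (x, F x) = 0`. -/
lemma deriv_implicit {x : ℝ} (hX : DifferentiableAt ℝ X (x, F x)) (hF : DifferentiableAt ℝ F x)
    (h : ∀ᶠ s in nhds x, F s + X (s, F s) = 0) :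
    deriv F x * (1 + fderiv ℝ X (x, F x) (0, 1)) = -fderiv ℝ X (x, F x) (1, 0) := by
  have h1 : HasDerivAt (fun s => (s, F s)) ((1 : ℝ), deriv F x) x :=
    (hasDerivAt_id x).prodMk hF.hasDerivAt
  have h2 := hF.hasDerivAt.add (HasFDerivAt.comp_hasDerivAt (f := fun s : ℝ => (s, F s)) x
    hX.hasFDerivAt h1)
  have h3 := h2.unique ((hasDerivAt_const x (0 : ℝ)).congr_of_eventuallyEq h)
  have h4 : ((1 : ℝ), deriv F x) = (1, 0) + deriv F x • ((0 : ℝ), (1 : ℝ)) := by simp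
  rw [h4, map_add, map_smul, smul_eq_mul] at h3
  linarith

end Straightening

/-- The straightened system of a monodromic nilpotent singularity has a regular blow-up. -/
lemma System19Setup.exists_isBlowUp {n : ℕ} (hn : 2 ≤ n) {X Y : ℝ × ℝ → ℝ} {F g f : ℝ → ℝ}
    {a b : ℝ} {P Pb : ℝ → ℝ} (h : System19Setup n X Y F g f a b P Pb) :
    ∃ M T, IsBlowUp n (straightX X F) (straightY X Y F) M T := by
  obtain ⟨hX, hY, hXO, -, hF, hF0, hFX, hg, hf, -, ⟨u, hu, hu0, hgu⟩, ⟨w, hw, hw0, hfw⟩, hab,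
    -⟩ := h
  have hdX : HasFDerivAt X (0 : ℝ × ℝ →L[ℝ] ℝ) (0, 0) := by
    refine Asymptotics.IsBigO.hasFDerivAt (n := 2) ?_ one_lt_two
    rw [show ((0, 0) : ℝ × ℝ) = 0 from rfl]
    have hX0 : X 0 = 0 := by simpa using hXO.eq_zero_imp.self_of_nhds
    simpa [hX0] using hXO
  have hgraph := tendsto_graph hF hF0
  have hdiff : ∀ {H : ℝ × ℝ → ℝ}, AnalyticAt ℝ H (0, 0) →
      ∀ᶠ x in nhds (0 : ℝ), DifferentiableAt ℝ H (x, F x) := fun hH =>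
    hgraph.eventually (hH.eventually_analyticAt.mono fun _ h => h.differentiableAt)
  have hp0 : ∀ᶠ x in nhds (0 : ℝ), straightX X F (x, 0) = 0 := by
    filter_upwards [hFX] with x hx
    simpa [straightX] using hx
  obtain ⟨A, B, hA, hB, hA1, hpA, hqB⟩ := exists_normal_form (n := n)
    (analyticAt_straightX hX hF hF0) (analyticAt_straightY hX hY hF hF0) hu hw hp0
    (by simpa [hF0, hdX.fderiv] using hasDerivAt_straightX (F := F) (hdiff hX).self_of_nhds)
    (by
      filter_upwards [hp0, hgu] with x h1 h2
      rw [← h2, hg, straightY, h1]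
      simp)
    (by
      filter_upwards [hdiff hX, hdiff hY, hFX.eventually_nhds, hfw,
        hF.eventually_analyticAt] with x h1 h2 h3 h4 h5
      have h6 := hasDerivAt_straightY h1 h2
      rw [deriv_implicit h1 h5.differentiableAt h3] at h6
      rw [← h4, hf, (hasDerivAt_horizontal h1).deriv, (hasDerivAt_vertical h2).deriv]
      convert h6 using 1
      ring)
  exact _root_.exists_isBlowUp (by omega) hA hB hu hw hA1 (by rw [hu0, hw0]; exact hab) hpA hqB

/-- An orbit followed with another time parametrisation: if `c` solves the equation of
`γ` up to a positive time change and starts at the same point, then `γ` runs through `c`. -/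
lemma exists_time_of_reparametrization {E : Type*} [NormedAddCommGroup E] [NormedSpace ℝ E]
    {V : E → E} {s : Set E} (hs : IsOpen s) {κ : NNReal} (hV : LipschitzOnWith κ V s)
    {γ c : ℝ → E} {r : ℝ → ℝ} {a b β : ℝ} (ha : a < 0) (hγ : ∀ t, HasDerivAt γ (V (γ t)) t)
    (hrc : ContinuousOn r (Ioo a b)) (hr : ∀ φ ∈ Ioo a b, 0 < r φ)
    (hc : ∀ φ ∈ Ioo a b, HasDerivAt c (r φ • V (c φ)) φ ∧ c φ ∈ s) (h0 : γ 0 = c 0)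
    (hβ : β ∈ Ioo 0 b) :
    ∃ τ > 0, γ τ = c β ∧ ∀ t ∈ Ioo 0 τ, ∃ φ ∈ Ioo 0 β, γ t = c φ := by
  have h0m : (0 : ℝ) ∈ Ioo a b := ⟨ha, hβ.1.trans hβ.2⟩
  set σ : ℝ → ℝ := fun φ => ∫ x in (0 : ℝ)..φ, r x with hσ
  have hσ' : ∀ φ ∈ Ioo a b, HasDerivAt σ (r φ) φ := by
    intro φ hφ
    have hsub : uIcc 0 φ ⊆ Ioo a b := ordConnected_Ioo.uIcc_subset h0m hφ
    exact intervalIntegral.integral_hasDerivAt_right (hrc.mono hsub).intervalIntegrable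
      (hrc.stronglyMeasurableAtFilter isOpen_Ioo φ hφ) (hrc.continuousAt (isOpen_Ioo.mem_nhds hφ))
  have hσ0 : σ 0 = 0 := by simp [hσ]
  have heq : EqOn (γ ∘ σ) c (Ioo a b) := by
    refine ODE_solution_eqOn_Ioo (v := fun t x => r t • V x) hs h0m ?_ ?_ hc
      (by simp [hσ0, h0])
    · intro t ht
      refine ⟨‖r t + 1‖₊ * κ, ?_⟩
      have hcont := hrc.continuousAt (isOpen_Ioo.mem_nhds ht)
      filter_upwards [hcont.eventually (gt_mem_nhds (lt_add_one (r t))),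
        isOpen_Ioo.mem_nhds ht] with t' h1 h2
      have h3 : ‖r t'‖₊ ≤ ‖r t + 1‖₊ := by
        rw [← NNReal.coe_le_coe, coe_nnnorm, coe_nnnorm, Real.norm_of_nonneg (hr t' h2).le,
          Real.norm_of_nonneg (by linarith [hr t ht])]
        exact h1.le
      refine LipschitzOnWith.of_dist_le_mul fun x hx y hy => ?_
      rw [dist_smul₀, NNReal.coe_mul, mul_assoc]
      exact mul_le_mul (by exact_mod_cast h3) (hV.dist_le_mul x hx y hy) dist_nonneg (by positivity)
    · intro t ht
      exact (hγ (σ t)).scomp t (hσ' t ht)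
  have hsub : Icc 0 β ⊆ Ioo a b := fun x hx => ⟨ha.trans_le hx.1, hx.2.trans_lt hβ.2⟩
  have hcont : ContinuousOn σ (Icc 0 β) := fun x hx =>
    (hσ' x (hsub hx)).continuousAt.continuousWithinAt
  have hmono : StrictMonoOn σ (Icc 0 β) := by
    refine strictMonoOn_of_deriv_pos (convex_Icc 0 β) hcont fun x hx => ?_
    have hx' := hsub (interior_subset hx)
    rw [(hσ' x hx').deriv]
    exact hr x hx'
  refine ⟨σ β, ?_, heq ⟨ha.trans hβ.1, hβ.2⟩, fun t ht => ?_⟩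
  · rw [gt_iff_lt, ← hσ0]
    exact hmono (left_mem_Icc.2 hβ.1.le) (right_mem_Icc.2 hβ.1.le) hβ.1
  · obtain ⟨φ, hφ, rfl⟩ := intermediate_value_Ioo hβ.1.le hcont (by rwa [hσ0])
    exact ⟨φ, hφ, heq (hsub (Ioo_subset_Icc_self hφ))⟩

lemma lipschitzOnWith_mul_exp {x₀ : ℝ} (hx : 0 ≤ x₀) (A : ℝ) :
    LipschitzOnWith (x₀ * Real.exp A).toNNReal (fun v => x₀ * Real.exp v) (closedBall 0 A) := by
  refine (convex_closedBall _ _).lipschitzOnWith_of_nnnorm_deriv_le (fun v _ => by fun_prop)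
    fun v hv => ?_
  rw [mem_closedBall_zero_iff, Real.norm_eq_abs] at hv
  simp only [deriv_const_mul_field', Real.deriv_exp]
  rw [← NNReal.coe_le_coe, coe_nnnorm, Real.coe_toNNReal _ (by positivity),
    Real.norm_of_nonneg (by positivity)]
  gcongr
  exact (le_abs_self v).trans hv

lemma mapsTo_mul_exp {x₀ A δ : ℝ} (hx : 0 < x₀) (hxδ : x₀ * Real.exp A ≤ δ) :
    MapsTo (fun v => x₀ * Real.exp v) (closedBall 0 A) (Icc (-δ) δ) := by
  intro v hv
  rw [mem_closedBall_zero_iff, Real.norm_eq_abs] at hv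
  have h1 : x₀ * Real.exp v ≤ x₀ * Real.exp A := by
    gcongr
    exact (le_abs_self v).trans hv
  have h2 : 0 < x₀ * Real.exp v := by positivity
  constructor <;> simp only <;> linarith

/-- The equation `v' = h (x₀ eᵛ, φ)`, for `x₀ > 0` small, has a solution on a given interval. -/
lemma exists_log_radius {h : ℝ × ℝ → ℝ} {a b δ K : ℝ} {L : NNReal} (ha : a < 0) (hb : 0 < b)
    (hab : -a ≤ b) (hcont : ContinuousOn h (Icc (-δ) δ ×ˢ Icc a b))
    (hK : ∀ z ∈ Icc (-δ) δ ×ˢ Icc a b, |h z| ≤ K)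
    (hL : ∀ φ ∈ Icc a b, LipschitzOnWith L (fun ρ => h (ρ, φ)) (Icc (-δ) δ))
    {x₀ : ℝ} (hx : 0 < x₀) (hxδ : x₀ * Real.exp (b * K) ≤ δ) :
    ∃ v : ℝ → ℝ, v 0 = 0 ∧ ∀ φ ∈ Ioo a b,
      HasDerivAt v (h (x₀ * Real.exp (v φ), φ)) φ ∧ |v φ| ≤ b * K := by
  have hδ : 0 < δ := (by positivity : 0 < x₀ * Real.exp (b * K)).trans_le hxδ
  have hK0 : 0 ≤ K := (abs_nonneg _).trans
    (hK (0, 0) ⟨⟨by simpa using hδ.le, hδ.le⟩, ⟨ha.le, hb.le⟩⟩)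
  have hmem : MapsTo (fun v => x₀ * Real.exp v) (closedBall 0 (b * K)) (Icc (-δ) δ) :=
    mapsTo_mul_exp hx hxδ
  have hPL : IsPicardLindelof (fun φ v => h (x₀ * Real.exp v, φ))
      (⟨0, ha.le, hb.le⟩ : Icc a b) 0 (b * K).toNNReal 0 K.toNNReal
      (L * (x₀ * Real.exp (b * K)).toNNReal) := by
    have e : ((b * K).toNNReal : ℝ) = b * K := Real.coe_toNNReal _ (by positivity)
    have e' : (K.toNNReal : ℝ) = K := Real.coe_toNNReal _ hK0
    refine ⟨fun φ hφ => ?_, fun v hv => ?_, fun φ hφ v hv => ?_, ?_⟩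
    · rw [e]
      exact (hL φ hφ).comp (lipschitzOnWith_mul_exp hx.le _) hmem
    · rw [e] at hv
      exact hcont.comp (by fun_prop) fun φ hφ => ⟨hmem hv, hφ⟩
    · rw [e] at hv
      rw [e']
      exact hK _ ⟨hmem hv, hφ⟩
    · rw [e, e']
      simp only [sub_zero, zero_sub, NNReal.coe_zero]
      rw [max_eq_left hab, mul_comm]
  obtain ⟨v, hv0, hv⟩ := hPL.exists_forall_mem_closedBall
  refine ⟨v, hv0, fun φ hφ => ?_⟩
  obtain ⟨h1, h2⟩ := hv φ (Ioo_subset_Icc_self hφ)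
  rw [mem_closedBall_zero_iff, Real.norm_eq_abs, Real.coe_toNNReal _ (by positivity)] at h1
  exact ⟨h2.hasDerivAt (Icc_mem_nhds hφ.1 hφ.2), h1⟩

/-- Uniform estimates for a blow-up over `[-δ, δ] × [a, b]`. -/
structure BlowUpBounds (n : ℕ) (p q M T : ℝ × ℝ → ℝ) (a b δ m K : ℝ) (L : NNReal) : Prop where
  pos_bound : 0 < m
  analyticAt_radial : ∀ z ∈ Icc (-δ) δ ×ˢ Icc a b, AnalyticAt ℝ M z
  analyticAt_angular : ∀ z ∈ Icc (-δ) δ ×ˢ Icc a b, AnalyticAt ℝ T z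
  le_angular : ∀ z ∈ Icc (-δ) δ ×ˢ Icc a b, m ≤ T z
  radial_eq : ∀ z ∈ Icc (-δ) δ ×ˢ Icc a b, z.1 ^ (2 * n - 1) * M z =
    z.1 ^ (n - 1) * Real.cos z.2 * p (blowPoint n z.1 z.2) -
      Real.sin z.2 * q (blowPoint n z.1 z.2)
  angular_eq : ∀ z ∈ Icc (-δ) δ ×ˢ Icc a b, z.1 ^ (2 * n - 1) * T z =
    -(n * z.1 ^ (n - 1) * Real.sin z.2 * p (blowPoint n z.1 z.2)) -
      Real.cos z.2 * q (blowPoint n z.1 z.2)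
  abs_div_le : ∀ z ∈ Icc (-δ) δ ×ˢ Icc a b, |M z / T z| ≤ K
  lipschitz : ∀ φ ∈ Icc a b, LipschitzOnWith L (fun ρ => M (ρ, φ) / T (ρ, φ)) (Icc (-δ) δ)

lemma exists_forall_mem_strip {R : ℝ × ℝ → Prop} {a b : ℝ}
    (h : ∀ φ ∈ Icc a b, ∀ᶠ z in nhds ((0, φ) : ℝ × ℝ), R z) :
    ∃ δ > 0, ∀ z ∈ Icc (-δ) δ ×ˢ Icc a b, R z := by
  obtain ⟨δ, hδ, hball⟩ := Metric.eventually_nhds_iff_ball.1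
    (isCompact_Icc.eventually_forall_of_forall_eventually (P := fun x y => R (x, y)) h)
  refine ⟨δ / 2, by positivity, fun z hz => hball z.1 ?_ z.2 hz.2⟩
  rw [mem_ball_zero_iff, Real.norm_eq_abs, abs_lt]
  constructor <;> linarith [hz.1.1, hz.1.2]

lemma IsBlowUp.exists_bounds {n : ℕ} {p q M T : ℝ × ℝ → ℝ} (h : IsBlowUp n p q M T) (a b : ℝ) :
    ∃ δ > 0, ∃ m K : ℝ, ∃ L, BlowUpBounds n p q M T a b δ m K L := by
  have hev : ∀ φ ∈ Icc a b, ∀ᶠ z in nhds ((0, φ) : ℝ × ℝ),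
      AnalyticAt ℝ M z ∧ AnalyticAt ℝ T z ∧ 0 < T z ∧
      (z.1 ^ (2 * n - 1) * M z = z.1 ^ (n - 1) * Real.cos z.2 * p (blowPoint n z.1 z.2) -
        Real.sin z.2 * q (blowPoint n z.1 z.2)) ∧
      z.1 ^ (2 * n - 1) * T z = -(n * z.1 ^ (n - 1) * Real.sin z.2 * p (blowPoint n z.1 z.2)) -
        Real.cos z.2 * q (blowPoint n z.1 z.2) := by
    intro φ _
    filter_upwards [(h.analyticAt_radial φ).eventually_analyticAt,
      (h.analyticAt_angular φ).eventually_analyticAt,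
      (h.analyticAt_angular φ).continuousAt.eventually (lt_mem_nhds (h.angular_pos φ)),
      h.eventually_radial φ, h.eventually_angular φ] with z h1 h2 h3 h4 h5
    exact ⟨h1, h2, h3, h4, h5⟩
  obtain ⟨δ, hδ, hreg⟩ := exists_forall_mem_strip hev
  set S : Set (ℝ × ℝ) := Icc (-δ) δ ×ˢ Icc a b with hS
  have hSc : IsCompact S := isCompact_Icc.prod isCompact_Icc
  have han : ∀ z ∈ S, AnalyticAt ℝ (fun z => M z / T z) z := fun z hz =>
    (hreg z hz).1.div (hreg z hz).2.1 (hreg z hz).2.2.1.ne'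
  obtain ⟨m, hm, hmT⟩ : ∃ m > 0, ∀ z ∈ S, m ≤ T z := by
    rcases S.eq_empty_or_nonempty with he | hne
    · exact ⟨1, one_pos, by simp [he]⟩
    · obtain ⟨z₀, hz₀, hmin⟩ := hSc.exists_isMinOn hne
        (fun z hz => (hreg z hz).2.1.continuousAt.continuousWithinAt)
      exact ⟨T z₀, (hreg z₀ hz₀).2.2.1, fun z hz => hmin hz⟩
  obtain ⟨K, hK⟩ := hSc.exists_bound_of_continuousOn
    (fun z hz => (han z hz).continuousAt.continuousWithinAt)
  obtain ⟨L, hL⟩ := hSc.exists_bound_of_continuousOn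
    (fun z hz => (han z hz).fderiv.continuousAt.continuousWithinAt)
  refine ⟨δ, hδ, m, K, L.toNNReal, hm, fun z hz => (hreg z hz).1,
    fun z hz => (hreg z hz).2.1, hmT, fun z hz => (hreg z hz).2.2.2.1,
    fun z hz => (hreg z hz).2.2.2.2, hK, fun φ hφ => ?_⟩
  refine (convex_Icc _ _).lipschitzOnWith_of_nnnorm_hasDerivWithin_le
    (f' := fun ρ => fderiv ℝ (fun z => M z / T z) (ρ, φ) (1, 0)) (fun ρ hρ => ?_) fun ρ hρ => ?_
  · exact (hasDerivAt_horizontal (han (ρ, φ) ⟨hρ, hφ⟩).differentiableAt).hasDerivWithinAt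
  · rw [← NNReal.coe_le_coe, coe_nnnorm]
    have h1 := (fderiv ℝ (fun z => M z / T z) (ρ, φ)).le_opNorm ((1 : ℝ), (0 : ℝ))
    have h2 : ‖((1 : ℝ), (0 : ℝ))‖ = 1 := by simp [Prod.norm_def]
    rw [h2, mul_one] at h1
    exact h1.trans ((hL (ρ, φ) ⟨hρ, hφ⟩).trans (Real.le_coe_toNNReal L))

/-- A solution `v` of the logarithmic radius equation of a blow-up gives an orbit of the
straightened field, up to the time change `D / (ρ ^ (n - 1) T)` with `D = cos² + n sin²`. -/
lemma BlowUpBounds.hasDerivAt_blowPoint {n : ℕ} (hn : 1 ≤ n) {p q M T : ℝ × ℝ → ℝ}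
    {a b δ m K : ℝ} {L : NNReal} (hb : BlowUpBounds n p q M T a b δ m K L) {ρ : ℝ → ℝ} {φ : ℝ}
    (hφ : φ ∈ Icc a b) (hρ0 : 0 < ρ φ) (hρδ : ρ φ ≤ δ)
    (hρ : HasDerivAt ρ (ρ φ * (M (ρ φ, φ) / T (ρ φ, φ))) φ) :
    HasDerivAt (fun φ => ρ φ * Real.cos φ)
      ((Real.cos φ ^ 2 + n * Real.sin φ ^ 2) / (ρ φ ^ (n - 1) * T (ρ φ, φ)) *
        p (blowPoint n (ρ φ) φ)) φ ∧
    HasDerivAt (fun φ => -(ρ φ ^ n * Real.sin φ))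
      ((Real.cos φ ^ 2 + n * Real.sin φ ^ 2) / (ρ φ ^ (n - 1) * T (ρ φ, φ)) *
        q (blowPoint n (ρ φ) φ)) φ := by
  obtain ⟨k, rfl⟩ : ∃ k, n = k + 1 := ⟨n - 1, by omega⟩
  have hz : ((ρ φ, φ) : ℝ × ℝ) ∈ Icc (-δ) δ ×ˢ Icc a b := ⟨⟨by simp only; linarith, hρδ⟩, hφ⟩
  have hT : T (ρ φ, φ) ≠ 0 := (hb.pos_bound.trans_le (hb.le_angular _ hz)).ne'
  have h1 := hb.radial_eq _ hz
  have h2 := hb.angular_eq _ hz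
  have e1 : 2 * (k + 1) - 1 = 2 * k + 1 := by omega
  simp only [e1, Nat.add_sub_cancel] at h1 h2 ⊢
  have hρk : ρ φ ^ k ≠ 0 := (pow_pos hρ0 k).ne'
  have hp : (Real.cos φ ^ 2 + (k + 1 : ℕ) * Real.sin φ ^ 2) * p (blowPoint (k + 1) (ρ φ) φ) =
      ρ φ ^ k * ρ φ * (Real.cos φ * M (ρ φ, φ) - Real.sin φ * T (ρ φ, φ)) := by
    refine mul_left_cancel₀ hρk ?_
    linear_combination Real.sin φ * h2 - Real.cos φ * h1
  have hq : (Real.cos φ ^ 2 + (k + 1 : ℕ) * Real.sin φ ^ 2) * q (blowPoint (k + 1) (ρ φ) φ) =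
      -(ρ φ ^ k * (ρ φ ^ k * ρ φ)) *
        ((k + 1 : ℕ) * Real.sin φ * M (ρ φ, φ) + Real.cos φ * T (ρ φ, φ)) := by
    linear_combination (k + 1 : ℕ) * Real.sin φ * h1 + Real.cos φ * h2
  constructor
  · refine (hρ.mul (Real.hasDerivAt_cos φ)).congr_deriv ?_
    rw [div_mul_eq_mul_div, hp]
    field_simp
    ring
  · refine ((hρ.pow (k + 1)).mul (Real.hasDerivAt_sin φ)).neg.congr_deriv ?_
    rw [div_mul_eq_mul_div, hq]
    simp only [Nat.add_sub_cancel, Pi.pow_apply]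
    field_simp
    ring

/-- The return map of a monodromic nilpotent singularity is computed by its blow-up. -/
lemma System19Setup.returnMap_eq {n : ℕ} (hn : 2 ≤ n) {X Y : ℝ × ℝ → ℝ} {F g f : ℝ → ℝ}
    {a b : ℝ} {P Pb : ℝ → ℝ} (h : System19Setup n X Y F g f a b P Pb) {M T : ℝ × ℝ → ℝ}
    {δ m K : ℝ} {L : NNReal} (hδ : 0 < δ)
    (hb : BlowUpBounds n (straightX X F) (straightY X Y F) M T (-1) 7 δ m K L) :
    ∃ ε > 0, ∀ x₀, 0 < x₀ → x₀ < ε → ∀ v : ℝ → ℝ, v 0 = 0 →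
      (∀ φ ∈ Ioo (-1 : ℝ) 7,
        HasDerivAt v (M (x₀ * Real.exp (v φ), φ) / T (x₀ * Real.exp (v φ), φ)) φ ∧
          |v φ| ≤ 7 * K) →
      P x₀ = x₀ * Real.exp (v (2 * Real.pi)) := by
  obtain ⟨hX, hY, -, -, hF, hF0, -, -, -, -, -, -, -, ⟨-, ε₁, hε₁, hP⟩, -⟩ := h
  have hV : ContDiffAt ℝ 1 (fun w : ℝ × ℝ => (w.2 + X w, Y w)) (0, 0) :=
    ((analyticAt_snd.add hX).prod hY).contDiffAt
  obtain ⟨κ, t, ht, hLip⟩ := hV.exists_lipschitzOnWith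
  have hst : ∀ᶠ v in nhds ((0, 0) : ℝ × ℝ), (v.1, F v.1 + v.2) ∈ interior t := by
    have hc : ContinuousAt (fun v : ℝ × ℝ => (v.1, F v.1 + v.2)) (0, 0) := by
      have : ContinuousAt (fun v : ℝ × ℝ => F v.1) (0, 0) :=
        ContinuousAt.comp (g := F) hF.continuousAt continuousAt_fst
      exact continuousAt_fst.prodMk (this.add continuousAt_snd)
    have ht' : interior t ∈ nhds ((0, 0) : ℝ × ℝ) := interior_mem_nhds.2 ht
    exact hc.eventually_mem (by simpa [hF0] using ht')
  have hFd : ∀ᶠ v in nhds ((0, 0) : ℝ × ℝ), DifferentiableAt ℝ F v.1 :=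
    continuousAt_fst.eventually (hF.eventually_analyticAt.mono fun _ h => h.differentiableAt)
  obtain ⟨r, hr, hball⟩ := Metric.eventually_nhds_iff_ball.1 (hst.and hFd)
  set ε₂ := min (min δ 1) (r / 2) * Real.exp (-(7 * K)) with hε₂
  have hmin : 0 < min (min δ 1) (r / 2) := by positivity
  refine ⟨min ε₁ ε₂, by positivity, fun x₀ hx₀ hxε v hv0 hv => ?_⟩
  obtain ⟨γ, hγ0, hγ, τ, hτ, hτs, hτmin, hPx⟩ := hP x₀ hx₀.ne'
    (by rw [abs_of_pos hx₀]; exact hxε.trans_le (min_le_left _ _))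
  set ρ : ℝ → ℝ := fun φ => x₀ * Real.exp (v φ) with hρ
  have hρ0 : ∀ φ, 0 < ρ φ := fun φ => by positivity
  have hρle : ∀ φ ∈ Ioo (-1 : ℝ) 7, ρ φ ≤ min (min δ 1) (r / 2) := by
    intro φ hφ
    calc ρ φ ≤ ε₂ * Real.exp (7 * K) := by
          refine mul_le_mul (hxε.le.trans (min_le_right _ _)) ?_ (by positivity) (by positivity)
          exact Real.exp_le_exp.2 ((le_abs_self _).trans (hv φ hφ).2)
      _ = _ := by rw [hε₂, mul_assoc, ← Real.exp_add, neg_add_cancel, Real.exp_zero, mul_one]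
  have hρd : ∀ φ ∈ Ioo (-1 : ℝ) 7, HasDerivAt ρ (ρ φ * (M (ρ φ, φ) / T (ρ φ, φ))) φ := by
    intro φ hφ
    have := ((hv φ hφ).1.exp).const_mul x₀
    rwa [← mul_assoc] at this
  have hρδ : ∀ φ ∈ Ioo (-1 : ℝ) 7, ρ φ ≤ δ := fun φ hφ =>
    (hρle φ hφ).trans ((min_le_left _ _).trans (min_le_left _ _))
  have hmem : ∀ φ ∈ Ioo (-1 : ℝ) 7, ((ρ φ, φ) : ℝ × ℝ) ∈ Icc (-δ) δ ×ˢ Icc (-1 : ℝ) 7 :=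
    fun φ hφ => ⟨⟨by simp only; linarith [hρ0 φ], hρδ φ hφ⟩, Ioo_subset_Icc_self hφ⟩
  have hTpos : ∀ φ ∈ Ioo (-1 : ℝ) 7, 0 < T (ρ φ, φ) := fun φ hφ =>
    hb.pos_bound.trans_le (hb.le_angular _ (hmem φ hφ))
  have hnear : ∀ φ ∈ Ioo (-1 : ℝ) 7, blowPoint n (ρ φ) φ ∈ ball ((0, 0) : ℝ × ℝ) r := by
    intro φ hφ
    have h1 : ρ φ ≤ r / 2 := (hρle φ hφ).trans (min_le_right _ _)
    have h2 : ρ φ ^ n ≤ ρ φ := pow_le_of_le_one (hρ0 φ).le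
      ((hρle φ hφ).trans ((min_le_left _ _).trans (min_le_right _ _))) (by omega)
    have h3 : |ρ φ * Real.cos φ| ≤ ρ φ := by
      rw [abs_mul, abs_of_pos (hρ0 φ)]
      exact mul_le_of_le_one_right (hρ0 φ).le (Real.abs_cos_le_one φ)
    have h4 : |-(ρ φ ^ n * Real.sin φ)| ≤ ρ φ := by
      rw [abs_neg, abs_mul, abs_of_pos (pow_pos (hρ0 φ) n)]
      exact (mul_le_of_le_one_right (pow_pos (hρ0 φ) n).le (Real.abs_sin_le_one φ)).trans h2
    rw [show ((0, 0) : ℝ × ℝ) = 0 from rfl, mem_ball_zero_iff, blowPoint, Prod.norm_mk]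
    exact max_lt (h3.trans_lt (by linarith)) (h4.trans_lt (by linarith))
  set c : ℝ → ℝ × ℝ := fun φ =>
    (ρ φ * Real.cos φ, F (ρ φ * Real.cos φ) + -(ρ φ ^ n * Real.sin φ)) with hc
  have hcd : ∀ φ ∈ Ioo (-1 : ℝ) 7, HasDerivAt c
      (((Real.cos φ ^ 2 + n * Real.sin φ ^ 2) / (ρ φ ^ (n - 1) * T (ρ φ, φ))) •
        ((fun w : ℝ × ℝ => (w.2 + X w, Y w)) (c φ))) φ ∧ c φ ∈ interior t := by
    intro φ hφ
    obtain ⟨h1, h2⟩ := hball _ (hnear φ hφ)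
    refine ⟨?_, h1⟩
    obtain ⟨h3, h4⟩ := hb.hasDerivAt_blowPoint (by omega) (Ioo_subset_Icc_self hφ) (hρ0 φ)
      (hρδ φ hφ) (hρd φ hφ)
    have h5 := (HasDerivAt.comp (h₂ := F) φ h2.hasDerivAt h3).add h4
    refine (h3.prodMk h5).congr_deriv (Prod.ext rfl ?_)
    simp only [straightY, blowPoint, c, Prod.smul_mk, smul_eq_mul]
    ring
  have hpi : 2 * Real.pi ∈ Ioo (0 : ℝ) 7 := by
    constructor <;> linarith [Real.pi_pos, Real.pi_lt_d2]
  obtain ⟨τ', hτ', hγτ', hbefore⟩ := exists_time_of_reparametrization isOpen_interior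
    (hLip.mono interior_subset) (by norm_num : (-1 : ℝ) < 0)
    (γ := γ) (fun t => (hγ t).1.prodMk (hγ t).2) (r := fun φ =>
      (Real.cos φ ^ 2 + n * Real.sin φ ^ 2) / (ρ φ ^ (n - 1) * T (ρ φ, φ))) (by
      intro φ hφ
      have h1 : ContinuousAt ρ φ := (hρd φ hφ).continuousAt
      have h2 : ContinuousAt (fun φ => T (ρ φ, φ)) φ :=
        ContinuousAt.comp (g := T) (f := fun φ => (ρ φ, φ))
          (hb.analyticAt_angular _ (hmem φ hφ)).continuousAt (h1.prodMk continuousAt_id)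
      refine ContinuousAt.continuousWithinAt (ContinuousAt.div (by fun_prop) ((h1.pow _).mul h2) ?_)
      exact (mul_pos (pow_pos (hρ0 φ) _) (hTpos φ hφ)).ne') (by
      intro φ hφ
      refine div_pos ?_ (mul_pos (pow_pos (hρ0 φ) _) (hTpos φ hφ))
      have h1 : (1 : ℝ) ≤ n := by exact_mod_cast (by omega : 1 ≤ n)
      nlinarith [Real.sin_sq_add_cos_sq φ, sq_nonneg (Real.sin φ)]) hcd
    (by simp [hγ0, c, hρ, hv0]) hpi
  have hc2π : c (2 * Real.pi) = (ρ (2 * Real.pi), F (ρ (2 * Real.pi))) := by simp [c]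
  rw [hc2π] at hγτ'
  have hττ' : τ = τ' := by
    rcases lt_trichotomy τ τ' with hlt | heq | hgt
    · exfalso
      obtain ⟨φ, hφ, hγφ⟩ := hbefore τ ⟨hτ, hlt⟩
      rw [hγφ] at hτs
      obtain ⟨h1, h2⟩ := hτs
      have h3 : Real.sin φ = 0 := by
        have : ρ φ ^ n * Real.sin φ = 0 := by
          simp only [c] at h1
          linarith
        exact (mul_eq_zero.1 this).resolve_left (pow_pos (hρ0 φ) n).ne'
      have h4 : 0 < Real.cos φ := pos_of_mul_pos_right (pos_of_mul_pos_right h2 hx₀.le) (hρ0 φ).le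
      have h5 : Real.cos φ = 1 := by
        have := Real.sin_sq_add_cos_sq φ
        rw [h3] at this
        nlinarith
      exact hφ.1.ne' ((Real.cos_eq_one_iff_of_lt_of_lt (by linarith [hφ.1, hpi.1]) hφ.2).1 h5)
    · exact heq
    · refine absurd ?_ (hτmin τ' hτ' hgt)
      rw [hγτ']
      exact ⟨rfl, mul_pos hx₀ (hρ0 _)⟩
  rw [hPx, hττ', hγτ']

lemma AnalyticAt.isBigO_deriv_of_isBigO {f : ℝ → ℝ} (hf : AnalyticAt ℝ f 0) {m : ℕ}
    (h : f =O[nhds 0] fun x => x ^ (m + 1)) : deriv f =O[nhds 0] fun x => x ^ m := by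
  have hf0 : f 0 = 0 := by simpa using h.eq_zero_imp.self_of_nhds
  have h1 : ((m + 1 : ℕ) : ℕ∞) ≤ analyticOrderAt f 0 :=
    hf.le_analyticOrderAt_of_isBigO_right (h.mono nhdsWithin_le_nhds)
  have h2 : (m : ℕ∞) ≤ analyticOrderAt (deriv f) 0 :=
    (analyticOrderAt_deriv_ge_iff hf hf0).2 (by exact_mod_cast h1)
  obtain ⟨g, hg, hfg⟩ := (natCast_le_analyticOrderAt hf.deriv).1 h2
  have h3 := (Asymptotics.isBigO_refl (fun x : ℝ => x ^ m) (nhds 0)).mul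
    (hg.continuousAt.isBigO_one ℝ)
  simp only [mul_one] at h3
  refine h3.congr' ?_ EventuallyEq.rfl
  filter_upwards [hfg] with x hx
  simp [hx]

section JetComparison

variable {X Xt Y Yt : ℝ × ℝ → ℝ} {F Ft : ℝ → ℝ} {N : ℕ}

lemma isBigO_of_vanish {E F : Type*} [NormedAddCommGroup E] [NormedSpace ℝ E]
    [NormedAddCommGroup F] [NormedSpace ℝ F] {f : E → F} (hf : DifferentiableAt ℝ f 0)
    (hf0 : f 0 = 0) : f =O[nhds 0] fun x => ‖x‖ := by
  simpa [hf0] using hf.isBigO_sub.norm_right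

lemma tendsto_straighten (hF : AnalyticAt ℝ F 0) (hF0 : F 0 = 0) :
    Tendsto (fun v : ℝ × ℝ => (v.1, F v.1 + v.2)) (nhds 0) (nhds 0) := by
  have h1 : ContinuousAt (fun v : ℝ × ℝ => F v.1) 0 :=
    ContinuousAt.comp (g := F) hF.continuousAt continuousAt_fst
  have h2 : ContinuousAt (fun v : ℝ × ℝ => (v.1, F v.1 + v.2)) 0 :=
    continuousAt_fst.prodMk (h1.add continuousAt_snd)
  simpa [ContinuousAt, hF0, Prod.mk_zero_zero] using h2

lemma isBigO_straighten (hF : AnalyticAt ℝ F 0) (hF0 : F 0 = 0) :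
    (fun v : ℝ × ℝ => (v.1, F v.1 + v.2)) =O[nhds 0] fun v => ‖v‖ := by
  have h1 : DifferentiableAt ℝ (fun v : ℝ × ℝ => F v.1) 0 :=
    DifferentiableAt.comp (g := F) _ hF.differentiableAt differentiableAt_fst
  exact isBigO_of_vanish (differentiableAt_fst.prodMk (h1.add differentiableAt_snd)) (by simp [hF0])

lemma isBigO_graph_sub (hX : AnalyticAt ℝ X 0) (hXO : X =O[nhds 0] fun p => ‖p‖ ^ 2)
    (hF : AnalyticAt ℝ F 0) (hF0 : F 0 = 0) (hFX : ∀ᶠ x in nhds 0, F x + X (x, F x) = 0)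
    (hFt : AnalyticAt ℝ Ft 0) (hFt0 : Ft 0 = 0) (hFtX : ∀ᶠ x in nhds 0, Ft x + Xt (x, Ft x) = 0)
    (hXX : (fun p => X p - Xt p) =O[nhds 0] fun p => ‖p‖ ^ (N + 1)) :
    (fun x => F x - Ft x) =O[nhds 0] fun x => x ^ (N + 1) := by
  have hdX : fderiv ℝ X 0 = 0 := by
    refine HasFDerivAt.fderiv (Asymptotics.IsBigO.hasFDerivAt (n := 2) ?_ one_lt_two)
    have hX0 : X 0 = 0 := by simpa using hXO.eq_zero_imp.self_of_nhds
    simpa [hX0] using hXO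
  have hst := hX.hasStrictFDerivAt
  rw [hdX] at hst
  have hg : Tendsto (fun x => (x, F x)) (nhds 0) (nhds (0 : ℝ × ℝ)) := tendsto_graph hF hF0
  have hgt : Tendsto (fun x => (x, Ft x)) (nhds 0) (nhds (0 : ℝ × ℝ)) := tendsto_graph hFt hFt0
  have h1 : (fun x => X (x, F x) - X (x, Ft x)) =o[nhds 0] fun x => F x - Ft x := by
    have h := hst.isLittleO.comp_tendsto (hg.prodMk_nhds hgt)
    refine (h.congr_left fun x => by simp).trans_le fun x => ?_
    simp [Prod.norm_mk]
  have h2 : (fun x => X (x, Ft x) - Xt (x, Ft x)) =O[nhds 0] fun x => x ^ (N + 1) := by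
    have h3 : (fun x => (x, Ft x)) =O[nhds 0] fun x : ℝ => x :=
      (isBigO_of_vanish (differentiableAt_id.prodMk hFt.differentiableAt)
        (by simp [hFt0])).of_norm_right
    exact (hXX.comp_tendsto hgt).trans (h3.norm_left.pow (N + 1))
  have h4 : (fun x => (F x - Ft x) + (X (x, F x) - X (x, Ft x))) =O[nhds 0]
      fun x => x ^ (N + 1) := by
    refine h2.neg_left.congr' ?_ EventuallyEq.rfl
    filter_upwards [hFX, hFtX] with x h5 h6
    linear_combination h6 - h5
  exact h1.right_isBigO_add.trans (h4.congr_left fun x => add_comm _ _)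

lemma isBigO_comp_straighten_sub {H Ht : ℝ × ℝ → ℝ} (hH : AnalyticAt ℝ H 0)
    (hF : AnalyticAt ℝ F 0) (hF0 : F 0 = 0) (hFt : AnalyticAt ℝ Ft 0) (hFt0 : Ft 0 = 0)
    (hFF : (fun x => F x - Ft x) =O[nhds 0] fun x => x ^ (N + 1))
    (hHH : (fun p => H p - Ht p) =O[nhds 0] fun p => ‖p‖ ^ (N + 1)) :
    (fun v : ℝ × ℝ => H (v.1, F v.1 + v.2) - Ht (v.1, Ft v.1 + v.2)) =O[nhds 0]
      fun v => ‖v‖ ^ (N + 1) := by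
  have hfst : Tendsto (Prod.fst : ℝ × ℝ → ℝ) (nhds 0) (nhds 0) := continuous_fst.tendsto 0
  have h0 : (fun v : ℝ × ℝ => F v.1 - Ft v.1) =O[nhds 0] fun v => ‖v‖ ^ (N + 1) :=
    (hFF.comp_tendsto hfst).trans (Asymptotics.isBigO_fst_prod'.norm_right.pow (N + 1))
  have h1 : (fun v : ℝ × ℝ => H (v.1, F v.1 + v.2) - H (v.1, Ft v.1 + v.2)) =O[nhds 0]
      fun v => F v.1 - Ft v.1 := by
    refine (hH.hasStrictFDerivAt.isBigO_sub.comp_tendsto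
      ((tendsto_straighten hF hF0).prodMk_nhds (tendsto_straighten hFt hFt0))).trans_le fun v => ?_
    simp [Prod.norm_mk]
  have h2 : (fun v : ℝ × ℝ => H (v.1, Ft v.1 + v.2) - Ht (v.1, Ft v.1 + v.2)) =O[nhds 0]
      fun v => ‖v‖ ^ (N + 1) :=
    (hHH.comp_tendsto (tendsto_straighten hFt hFt0)).trans
      ((isBigO_straighten hFt hFt0).norm_left.pow (N + 1))
  exact ((h1.trans h0).add h2).congr_left fun v => by ring

lemma isBigO_straightX_sub (hX : AnalyticAt ℝ X 0)
    (hF : AnalyticAt ℝ F 0) (hF0 : F 0 = 0) (hFt : AnalyticAt ℝ Ft 0) (hFt0 : Ft 0 = 0)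
    (hFF : (fun x => F x - Ft x) =O[nhds 0] fun x => x ^ (N + 1))
    (hXX : (fun p => X p - Xt p) =O[nhds 0] fun p => ‖p‖ ^ (N + 1)) :
    (fun v => straightX X F v - straightX Xt Ft v) =O[nhds 0] fun v => ‖v‖ ^ (N + 1) := by
  have h := isBigO_comp_straighten_sub (H := fun p => p.2 + X p) (Ht := fun p => p.2 + Xt p)
    (AnalyticAt.add analyticAt_snd hX) hF hF0 hFt hFt0 hFF (by simpa using hXX)
  exact h

lemma isBigO_straightY_sub (hX : AnalyticAt ℝ X 0) (hXt : AnalyticAt ℝ Xt 0) (hXt0 : Xt 0 = 0)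
    (hY : AnalyticAt ℝ Y 0)
    (hF : AnalyticAt ℝ F 0) (hF0 : F 0 = 0) (hFt : AnalyticAt ℝ Ft 0) (hFt0 : Ft 0 = 0)
    (hFF : (fun x => F x - Ft x) =O[nhds 0] fun x => x ^ (N + 1))
    (hXX : (fun p => X p - Xt p) =O[nhds 0] fun p => ‖p‖ ^ (N + 1))
    (hYY : (fun p => Y p - Yt p) =O[nhds 0] fun p => ‖p‖ ^ (N + 1)) :
    (fun v => straightY X Y F v - straightY Xt Yt Ft v) =O[nhds 0] fun v => ‖v‖ ^ (N + 1) := by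
  have hfst : Tendsto (Prod.fst : ℝ × ℝ → ℝ) (nhds 0) (nhds 0) := continuous_fst.tendsto 0
  have h1 := isBigO_comp_straighten_sub hY hF hF0 hFt hFt0 hFF hYY
  have h2 : (fun v : ℝ × ℝ => deriv F v.1 * (straightX X F v - straightX Xt Ft v)) =O[nhds 0]
      fun v => ‖v‖ ^ (N + 1) := by
    have h := ((hF.deriv.continuousAt.isBigO_one ℝ).comp_tendsto hfst).mul
      (isBigO_straightX_sub hX hF hF0 hFt hFt0 hFF hXX)
    simpa using h
  have h3 : (fun v : ℝ × ℝ => (deriv F v.1 - deriv Ft v.1) * straightX Xt Ft v) =O[nhds 0]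
      fun v => ‖v‖ ^ (N + 1) := by
    have h4 : (fun x => deriv F x - deriv Ft x) =O[nhds 0] fun x => x ^ N := by
      refine (AnalyticAt.isBigO_deriv_of_isBigO (hF.sub hFt) hFF).congr' ?_ EventuallyEq.rfl
      filter_upwards [hF.eventually_analyticAt, hFt.eventually_analyticAt] with x h5 h6
      exact deriv_sub h5.differentiableAt h6.differentiableAt
    have h5 : straightX Xt Ft =O[nhds 0] fun v => ‖v‖ :=
      isBigO_of_vanish (analyticAt_straightX hXt hFt hFt0).differentiableAt
        (by simpa [straightX, hFt0, Prod.mk_zero_zero] using hXt0)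
    exact ((h4.comp_tendsto hfst).trans
      (Asymptotics.isBigO_fst_prod'.norm_right.pow N)).mul h5
  refine ((h1.sub h2).sub h3).congr_left fun v => ?_
  simp only [straightY]
  ring

end JetComparison

/-- Grönwall comparison of the radii solving `ρ' = ρ h (ρ, φ)` and `ρ' = ρ h̃ (ρ, φ)`. -/
lemma exists_radius_sub_le {h ht : ℝ × ℝ → ℝ} {b δ C : ℝ} (A : ℝ) {L : NNReal} {j : ℕ}
    (hb : 0 ≤ b) (hC : 0 ≤ C)
    (hL : ∀ φ ∈ Icc 0 b, LipschitzOnWith L (fun ρ => h (ρ, φ)) (Icc (-δ) δ))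
    (hsub : ∀ φ ∈ Icc 0 b, ∀ ρ ∈ Ioc 0 δ, |h (ρ, φ) - ht (ρ, φ)| ≤ C * ρ ^ j) :
    ∃ C', ∀ x₀, 0 < x₀ → x₀ * Real.exp A ≤ δ → ∀ v w : ℝ → ℝ, v 0 = w 0 →
      (∀ φ ∈ Icc 0 b, HasDerivAt v (h (x₀ * Real.exp (v φ), φ)) φ ∧ |v φ| ≤ A) →
      (∀ φ ∈ Icc 0 b, HasDerivAt w (ht (x₀ * Real.exp (w φ), φ)) φ ∧ |w φ| ≤ A) →
      |x₀ * Real.exp (v b) - x₀ * Real.exp (w b)| ≤ C' * x₀ ^ (j + 1) := by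
  set κ : NNReal := L * δ.toNNReal + 1 with hκ
  refine ⟨Real.exp A * (C * Real.exp A ^ j / κ * (Real.exp (κ * b) - 1)),
    fun x₀ hx hxδ v w hvw hv hw => ?_⟩
  have hball : ∀ {u : ℝ}, |u| ≤ A → u ∈ closedBall (0 : ℝ) A := fun hu => by
    rwa [mem_closedBall_zero_iff, Real.norm_eq_abs]
  have hlip : ∀ φ ∈ Ico 0 b, LipschitzOnWith κ (fun u => h (x₀ * Real.exp u, φ))
      (closedBall 0 A) := by
    intro φ hφ
    refine ((hL φ (Ico_subset_Icc_self hφ)).comp (lipschitzOnWith_mul_exp hx.le A)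
      (mapsTo_mul_exp hx hxδ)).weaken ?_
    rw [hκ]
    refine le_add_right ?_
    gcongr
  have hgron := dist_le_of_approx_trajectories_ODE_of_mem hlip
    (fun φ hφ => (hv φ hφ).1.continuousAt.continuousWithinAt)
    (fun φ hφ => (hv φ (Ico_subset_Icc_self hφ)).1.hasDerivWithinAt)
    (εf := 0) (fun φ _ => by simp)
    (fun φ hφ => hball (hv φ (Ico_subset_Icc_self hφ)).2)
    (fun φ hφ => (hw φ hφ).1.continuousAt.continuousWithinAt)
    (fun φ hφ => (hw φ (Ico_subset_Icc_self hφ)).1.hasDerivWithinAt)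
    (εg := C * (x₀ * Real.exp A) ^ j) (fun φ hφ => by
      have hw' := (hw φ (Ico_subset_Icc_self hφ)).2
      have h1 : x₀ * Real.exp (w φ) ≤ x₀ * Real.exp A := by
        gcongr
        exact (le_abs_self _).trans hw'
      have h2 : 0 < x₀ * Real.exp (w φ) := by positivity
      rw [dist_comm, Real.dist_eq]
      refine (hsub φ (Ico_subset_Icc_self hφ) _ ⟨h2, h1.trans hxδ⟩).trans ?_
      gcongr)
    (fun φ hφ => hball (hw φ (Ico_subset_Icc_self hφ)).2)
    (δ := 0) (by rw [hvw, dist_self]) b ⟨hb, le_rfl⟩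
  have hκ0 : (κ : ℝ) ≠ 0 := by
    rw [hκ, NNReal.coe_add, NNReal.coe_one]
    positivity
  rw [gronwallBound_of_K_ne_0 hκ0] at hgron
  have hexp := (lipschitzOnWith_mul_exp hx.le A).dist_le_mul (v b)
    (hball (hv b ⟨hb, le_rfl⟩).2) (w b) (hball (hw b ⟨hb, le_rfl⟩).2)
  rw [Real.coe_toNNReal _ (by positivity), Real.dist_eq] at hexp
  refine hexp.trans ((mul_le_mul_of_nonneg_left hgron (by positivity)).trans_eq ?_)
  simp only [zero_add, zero_mul, sub_zero]
  ring

/-- Fields that agree to high order have blow-ups that agree to high order. -/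
lemma BlowUpBounds.exists_sub_le {n j N : ℕ} (hN : N + 1 = 2 * n - 1 + j) (hn : 1 ≤ n)
    {p q M T pt qt Mt Tt : ℝ × ℝ → ℝ} {a b δ m K δt mt Kt : ℝ} {L Lt : NNReal}
    (hδ : 0 < δ) (hδt : 0 < δt)
    (h : BlowUpBounds n p q M T a b δ m K L) (ht : BlowUpBounds n pt qt Mt Tt a b δt mt Kt Lt)
    (hp : (fun v => p v - pt v) =O[nhds 0] fun v => ‖v‖ ^ (N + 1))
    (hq : (fun v => q v - qt v) =O[nhds 0] fun v => ‖v‖ ^ (N + 1)) :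
    ∃ r > 0, ∃ C ≥ 0, r ≤ δ ∧ r ≤ δt ∧ ∀ φ ∈ Icc a b, ∀ ρ ∈ Ioc 0 r,
      |M (ρ, φ) / T (ρ, φ) - Mt (ρ, φ) / Tt (ρ, φ)| ≤ C * ρ ^ j := by
  obtain ⟨c, hc, hpc⟩ := hp.exists_nonneg
  obtain ⟨d, hd, hqd⟩ := hq.exists_nonneg
  obtain ⟨r, hr, hball⟩ := Metric.eventually_nhds_iff_ball.1 (hpc.bound.and hqd.bound)
  refine ⟨min (min δ δt) (min 1 (r / 2)), by positivity,
    ((c + d) + |Kt| * (n * c + d)) / m, ?_, (min_le_left _ _).trans (min_le_left _ _),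
    (min_le_left _ _).trans (min_le_right _ _), fun φ hφ ρ hρ => ?_⟩
  · have := h.pos_bound
    positivity
  obtain ⟨hρ0, hρr⟩ := hρ
  simp only [le_min_iff] at hρr
  obtain ⟨⟨hρδ, hρδt⟩, hρ1, hρr⟩ := hρr
  have hz : ((ρ, φ) : ℝ × ℝ) ∈ Icc (-δ) δ ×ˢ Icc a b := ⟨⟨by simp only; linarith, hρδ⟩, hφ⟩
  have hzt : ((ρ, φ) : ℝ × ℝ) ∈ Icc (-δt) δt ×ˢ Icc a b := ⟨⟨by simp only; linarith, hρδt⟩, hφ⟩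
  have hnorm : ‖blowPoint n ρ φ‖ ≤ ρ := by
    have h2 : ρ ^ n ≤ ρ := pow_le_of_le_one hρ0.le hρ1 (by omega)
    have h3 : |ρ * Real.cos φ| ≤ ρ := by
      rw [abs_mul, abs_of_pos hρ0]
      exact mul_le_of_le_one_right hρ0.le (Real.abs_cos_le_one φ)
    have h4 : |-(ρ ^ n * Real.sin φ)| ≤ ρ := by
      rw [abs_neg, abs_mul, abs_of_pos (pow_pos hρ0 n)]
      exact (mul_le_of_le_one_right (pow_pos hρ0 n).le (Real.abs_sin_le_one φ)).trans h2
    rw [blowPoint, Prod.norm_mk]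
    exact max_le h3 h4
  obtain ⟨h1, h2⟩ := hball (blowPoint n ρ φ) (by rw [mem_ball_zero_iff]; linarith)
  rw [norm_pow, norm_norm, Real.norm_eq_abs] at h1 h2
  have hpow := pow_le_pow_left₀ (norm_nonneg _) hnorm (N + 1)
  have h1 := h1.trans (mul_le_mul_of_nonneg_left hpow hc)
  have h2 := h2.trans (mul_le_mul_of_nonneg_left hpow hd)
  have hs := Real.abs_sin_le_one φ
  have hcos := Real.abs_cos_le_one φ
  have hρn : ρ ^ (n - 1) ≤ 1 := pow_le_one₀ hρ0.le hρ1
  have hρn0 : 0 < ρ ^ (n - 1) := pow_pos hρ0 _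
  have hρ2 : 0 < ρ ^ (2 * n - 1) := pow_pos hρ0 _
  rw [hN, pow_add] at h1 h2
  set Δp := p (blowPoint n ρ φ) - pt (blowPoint n ρ φ) with hΔp
  set Δq := q (blowPoint n ρ φ) - qt (blowPoint n ρ φ) with hΔq
  have h1' : |ρ ^ (n - 1) * Δp| ≤ c * (ρ ^ (2 * n - 1) * ρ ^ j) := by
    rw [abs_mul, abs_of_pos hρn0]
    exact (mul_le_of_le_one_left (abs_nonneg _) hρn).trans h1
  have hM : |M (ρ, φ) - Mt (ρ, φ)| ≤ (c + d) * ρ ^ j := by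
    refine le_of_mul_le_mul_left ?_ hρ2
    rw [← abs_of_pos hρ2, ← abs_mul, abs_of_pos hρ2]
    have e : ρ ^ (2 * n - 1) * (M (ρ, φ) - Mt (ρ, φ)) =
        Real.cos φ * (ρ ^ (n - 1) * Δp) - Real.sin φ * Δq := by
      have := h.radial_eq _ hz
      have := ht.radial_eq _ hzt
      simp only at *
      rw [hΔp, hΔq]
      linarith
    rw [e]
    refine (abs_sub _ _).trans ?_
    rw [abs_mul, abs_mul (Real.sin φ)]
    have := mul_le_of_le_one_left (abs_nonneg (ρ ^ (n - 1) * Δp)) hcos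
    have := mul_le_of_le_one_left (abs_nonneg Δq) hs
    linarith
  have hT : |Tt (ρ, φ) - T (ρ, φ)| ≤ (n * c + d) * ρ ^ j := by
    refine le_of_mul_le_mul_left ?_ hρ2
    rw [← abs_of_pos hρ2, ← abs_mul, abs_of_pos hρ2]
    have e : ρ ^ (2 * n - 1) * (Tt (ρ, φ) - T (ρ, φ)) =
        Real.sin φ * (n * (ρ ^ (n - 1) * Δp)) + Real.cos φ * Δq := by
      have := h.angular_eq _ hz
      have := ht.angular_eq _ hzt
      simp only at *
      rw [hΔp, hΔq]
      linarith
    rw [e]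
    refine (abs_add_le _ _).trans ?_
    rw [abs_mul, abs_mul (Real.cos φ)]
    have := mul_le_of_le_one_left (abs_nonneg (n * (ρ ^ (n - 1) * Δp))) hs
    have := mul_le_of_le_one_left (abs_nonneg Δq) hcos
    have : |n * (ρ ^ (n - 1) * Δp)| ≤ n * (c * (ρ ^ (2 * n - 1) * ρ ^ j)) := by
      rw [abs_mul, Nat.abs_cast]
      gcongr
    linarith
  have hm := h.pos_bound
  have hmT := h.le_angular _ hz
  have hT0 : 0 < T (ρ, φ) := hm.trans_le hmT
  have hTt0 : 0 < Tt (ρ, φ) := ht.pos_bound.trans_le (ht.le_angular _ hzt)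
  have e : M (ρ, φ) / T (ρ, φ) - Mt (ρ, φ) / Tt (ρ, φ) =
      ((M (ρ, φ) - Mt (ρ, φ)) + Mt (ρ, φ) / Tt (ρ, φ) * (Tt (ρ, φ) - T (ρ, φ))) / T (ρ, φ) := by
    field_simp
    ring
  rw [e, abs_div, abs_of_pos hT0, div_mul_eq_mul_div (_ + |Kt| * _)]
  refine div_le_div₀ (by positivity) ((abs_add_le _ _).trans ?_) hm hmT
  rw [abs_mul]
  have := mul_le_mul ((ht.abs_div_le _ hzt).trans (le_abs_self Kt)) hT (abs_nonneg _) (abs_nonneg _)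
  linarith

lemma BlowUpBounds.continuousOn_div {n : ℕ} {p q M T : ℝ × ℝ → ℝ} {a b δ m K : ℝ} {L : NNReal}
    (h : BlowUpBounds n p q M T a b δ m K L) :
    ContinuousOn (fun z => M z / T z) (Icc (-δ) δ ×ˢ Icc a b) := fun z hz =>
  ((h.analyticAt_radial z hz).continuousAt.div (h.analyticAt_angular z hz).continuousAt
    (h.pos_bound.trans_le (h.le_angular z hz)).ne').continuousWithinAt

/-- Return maps of systems that agree to high order agree to high order. -/
lemma System19Setup.returnMap_sub_isBigO {n j N : ℕ} (hn : 2 ≤ n) (hN : N + 1 = 2 * n - 1 + j)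
    {X Y Xt Yt : ℝ × ℝ → ℝ} {F g f Ft gt ft : ℝ → ℝ} {a b a' b' : ℝ} {P Pb Pt Pbt : ℝ → ℝ}
    (h : System19Setup n X Y F g f a b P Pb) (ht : System19Setup n Xt Yt Ft gt ft a' b' Pt Pbt)
    (hXX : (fun p => X p - Xt p) =O[nhds 0] fun p => ‖p‖ ^ (N + 1))
    (hYY : (fun p => Y p - Yt p) =O[nhds 0] fun p => ‖p‖ ^ (N + 1)) :
    (fun x => P x - Pt x) =O[nhdsWithin 0 (Ioi 0)] fun x => x ^ (j + 1) := by
  obtain ⟨M, T, hMT⟩ := h.exists_isBlowUp hn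
  obtain ⟨Mt, Tt, hMTt⟩ := ht.exists_isBlowUp hn
  obtain ⟨δ, hδ, m, K, L, hB⟩ := hMT.exists_bounds (-1) 7
  obtain ⟨δt, hδt, mt, Kt, Lt, hBt⟩ := hMTt.exists_bounds (-1) 7
  obtain ⟨ε, hε, hP⟩ := h.returnMap_eq hn hδ hB
  obtain ⟨εt, hεt, hPt⟩ := ht.returnMap_eq hn hδt hBt
  obtain ⟨hX, hY, hXO, -, hF, hF0, hFX, -⟩ := h
  obtain ⟨hXt, -, hXtO, -, hFt, hFt0, hFtX, -⟩ := ht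
  have hXt0 : Xt 0 = 0 := by simpa using hXtO.eq_zero_imp.self_of_nhds
  have hFF := isBigO_graph_sub hX hXO hF hF0 hFX hFt hFt0 hFtX hXX
  obtain ⟨r, hr, C, hC, hrδ, hrδt, hsub⟩ := hB.exists_sub_le hN (by omega) hδ hδt hBt
    (isBigO_straightX_sub hX hF hF0 hFt hFt0 hFF hXX)
    (isBigO_straightY_sub hX hXt hXt0 hY hF hF0 hFt hFt0 hFF hXX hYY)
  have hπ : 0 < 2 * Real.pi := Real.two_pi_pos
  have hπ7 : 2 * Real.pi < 7 := by linarith [Real.pi_lt_d2]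
  have hIcc : ∀ φ ∈ Icc 0 (2 * Real.pi), φ ∈ Icc (-1 : ℝ) 7 := fun φ hφ =>
    ⟨by linarith [hφ.1], by linarith [hφ.2]⟩
  have hIoo : ∀ φ ∈ Icc 0 (2 * Real.pi), φ ∈ Ioo (-1 : ℝ) 7 := fun φ hφ =>
    ⟨by linarith [hφ.1], by linarith [hφ.2]⟩
  set A := max (7 * K) (7 * Kt) with hA
  obtain ⟨C', hC'⟩ := exists_radius_sub_le (h := fun z => M z / T z)
    (ht := fun z => Mt z / Tt z) A hπ.le hC
    (fun φ hφ => (hB.lipschitz φ (hIcc φ hφ)).mono (Icc_subset_Icc (by linarith) hrδ))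
    (fun φ hφ => hsub φ (hIcc φ hφ))
  refine Asymptotics.IsBigO.of_bound C' ?_
  have hs : 0 < min (min ε εt) (r / Real.exp A) := by positivity
  filter_upwards [Ioo_mem_nhdsGT hs] with x ⟨hx, hxs⟩
  simp only [lt_min_iff] at hxs
  obtain ⟨⟨hxε, hxεt⟩, hxr⟩ := hxs
  have hxr : x * Real.exp A ≤ r := ((lt_div_iff₀ (Real.exp_pos A)).1 hxr).le
  have hexp : ∀ {s}, s ≤ A → x * Real.exp s ≤ r := fun hs =>
    (mul_le_mul_of_nonneg_left (Real.exp_le_exp.2 hs) hx.le).trans hxr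
  obtain ⟨v, hv0, hv⟩ := exists_log_radius (h := fun z => M z / T z) (by norm_num) (by norm_num)
    (by norm_num) hB.continuousOn_div hB.abs_div_le hB.lipschitz hx
    ((hexp (le_max_left _ _)).trans hrδ)
  obtain ⟨w, hw0, hw⟩ := exists_log_radius (h := fun z => Mt z / Tt z) (by norm_num) (by norm_num)
    (by norm_num) hBt.continuousOn_div hBt.abs_div_le hBt.lipschitz hx
    ((hexp (le_max_right _ _)).trans hrδt)
  rw [hP x hx hxε v hv0 hv, hPt x hx hxεt w hw0 hw, Real.norm_eq_abs, Real.norm_eq_abs,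
    abs_of_pos (pow_pos hx _)]
  exact hC' x hx hxr v w (hv0.trans hw0.symm)
    (fun φ hφ => ⟨(hv φ (hIoo φ hφ)).1, (hv φ (hIoo φ hφ)).2.trans (le_max_left _ _)⟩)
    (fun φ hφ => ⟨(hw φ (hIoo φ hφ)).1, (hw φ (hIoo φ hφ)).2.trans (le_max_right _ _)⟩)

/-- **Corollary 1.1.**  If two systems of the form (1.9), both satisfying (1.11)
and (1.12) with the same `n ≥ 2`, have the same Taylor expansions at the origin up
to degree `(k+2)n - 2` (for `X` and likewise for `Y`), then the coefficients
`v₁, …, v_{kn}` of the expansions `P(x₀) - x₀ = Σ_{j≥1} v_j x₀^j` of their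
Poincaré return maps coincide. -/
theorem return_map_coefficients_depend_only_on_finite_jet
    (n k : ℕ) (hn : 2 ≤ n) (hk : 1 ≤ k)
    (XX YY XXt YYt : ℝ × ℝ → ℝ) (F Ft g f gt ft : ℝ → ℝ) (a b at' bt : ℝ)
    (P Pb Pt Pbt : ℝ → ℝ)
    (hsys : System19Setup n XX YY F g f a b P Pb)
    (hsyst : System19Setup n XXt YYt Ft gt ft at' bt Pt Pbt)
    -- the Taylor expansions of `X, X̃` and of `Y, Ỹ` agree up to degree `(k+2)n - 2`
    (hjetX : ∀ j : ℕ, j ≤ (k + 2) * n - 2 →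
      iteratedFDeriv ℝ j XX (0, 0) = iteratedFDeriv ℝ j XXt (0, 0))
    (hjetY : ∀ j : ℕ, j ≤ (k + 2) * n - 2 →
      iteratedFDeriv ℝ j YY (0, 0) = iteratedFDeriv ℝ j YYt (0, 0)) :
    ∀ j : ℕ, 1 ≤ j → j ≤ k * n →
      iteratedDeriv j (fun x₀ => Pb x₀ - x₀) 0 =
      iteratedDeriv j (fun x₀ => Pbt x₀ - x₀) 0 := by
  intro j _ hj
  have hN : (k + 2) * n - 2 + 1 = 2 * n - 1 + k * n := by
    rw [add_mul]
    omega
  have hXX := hsys.1.isBigO_sub_of_iteratedFDeriv_eq hsyst.1 hjetX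
  have hYY := hsys.2.1.isBigO_sub_of_iteratedFDeriv_eq hsyst.2.1 hjetY
  simp only [Prod.mk_zero_zero, zero_add] at hXX hYY
  have hPP := hsys.returnMap_sub_isBigO hn hN hsyst hXX hYY
  obtain ⟨-, -, -, -, -, -, -, -, -, -, -, -, -, -, hPb, -, -, hP⟩ := hsys
  obtain ⟨-, -, -, -, -, -, -, -, -, -, -, -, -, -, hPbt, -, -, hPt⟩ := hsyst
  have hord := (hPb.sub hPbt).le_analyticOrderAt_of_isBigO_right
    (hPP.congr' (EventuallyEq.sub hP hPt) EventuallyEq.rfl)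
  have hzero := (natCast_le_analyticOrderAt_iff_iteratedDeriv_eq_zero (hPb.sub hPbt)).1 hord j
    (by omega)
  rw [iteratedDeriv_sub hPb.contDiffAt hPbt.contDiffAt, sub_eq_zero] at hzero
  rw [iteratedDeriv_fun_sub hPb.contDiffAt contDiffAt_fun_id,
    iteratedDeriv_fun_sub hPbt.contDiffAt contDiffAt_fun_id, hzero]
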